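/- arXiv:1301.2636 — 6 statements merged into one kernel-verified Lean document; each statement's English description precedes it below -/
import Mathlib

section
/- If a compact set K in the circle supports a nonzero probability measure μ such that ∑_{n≠0} |μ̂(n)|²/|n|^{1-a} < ∞ for some 0 < a < 1, then the Hausdorff dimension of K is at least a. -/
open MeasureTheory Complex

/-- The `n`-th Fourier coefficient of a measure `μ` on the circle `ℝ/2πℤ`,
`μ̂(n) = ∫ e^{-int} dμ(t)`. -/
noncomputable def measureFourierCoeff (μ : Measure (AddCircle (2 * Real.pi))) (n : ℤ) : ℂ :=
  ∫ x, (fourier (-n) x : ℂ) ∂μ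

open scoped ENNReal NNReal

/-- Mass distribution principle along dyadic radii. -/
theorem le_dimH_of_measure_dyadic_ball_le {X : Type*} [EMetricSpace X] [MeasurableSpace X]
    [BorelSpace X] (μ : Measure X) {A : Set X} (hA : MeasurableSet A) (hμA : μ A ≠ 0)
    {s : ℝ≥0} (hs : 0 < s) {M : ℝ≥0∞} (hM : M ≠ ∞)
    (h : ∀ x ∈ A, ∀ k : ℕ,
      μ {y | edist x y ≤ (2⁻¹ : ℝ≥0∞) ^ k} ≤ M * ((2⁻¹ : ℝ≥0∞) ^ k) ^ (s : ℝ)) :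
    (s : ℝ≥0∞) ≤ dimH A := by
  have hs' : (0 : ℝ) < s := by exact_mod_cast hs
  have h2 : (2⁻¹ : ℝ≥0∞) < 1 := by norm_num
  set C : ℝ≥0∞ := M * 2 ^ (s : ℝ) + 1 with hC
  have hC0 : C ≠ 0 := by simp [hC]
  have hCtop : C ≠ ∞ := by
    simp only [hC, ne_eq, ENNReal.add_eq_top, ENNReal.one_ne_top, or_false]
    exact ENNReal.mul_ne_top hM (ENNReal.rpow_ne_top_of_nonneg hs'.le (by simp))
  have key : ∀ t : Set X, Metric.ediam t ≤ 1 →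
      (μ.restrict A) t ≤ C * Metric.ediam t ^ (s : ℝ) := by
    intro t ht
    rw [Measure.restrict_apply' hA]
    rcases (t ∩ A).eq_empty_or_nonempty with he | ⟨x, hxt, hxA⟩
    · simp [he]
    have hsub : ∀ k : ℕ, Metric.ediam t ≤ (2⁻¹ : ℝ≥0∞) ^ k →
        μ (t ∩ A) ≤ M * ((2⁻¹ : ℝ≥0∞) ^ k) ^ (s : ℝ) := fun k hk =>
      (measure_mono fun y hy => (Metric.edist_le_ediam_of_mem hxt hy.1).trans hk).trans
        (h x hxA k)
    rcases eq_or_ne (Metric.ediam t) 0 with h0 | h0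
    · have hlim : Filter.Tendsto (fun k : ℕ => M * ((2⁻¹ : ℝ≥0∞) ^ k) ^ (s : ℝ))
          Filter.atTop (nhds (M * 0 ^ (s : ℝ))) :=
        ENNReal.Tendsto.const_mul
          ((ENNReal.tendsto_pow_atTop_nhds_zero_of_lt_one h2).ennrpow_const _) (Or.inr hM)
      have := ge_of_tendsto' hlim fun k => hsub k (by simp [h0])
      simpa [h0, ENNReal.zero_rpow_of_pos hs'] using this
    · have hfin : Metric.ediam t ≠ ∞ := (ht.trans_lt ENNReal.one_lt_top).ne
      obtain ⟨n, hn1, hn2⟩ := exists_nat_pow_near_of_lt_one (x := (Metric.ediam t).toReal)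
        (y := (2⁻¹ : ℝ)) (ENNReal.toReal_pos h0 hfin)
        (by simpa using ENNReal.toReal_mono ENNReal.one_ne_top ht) (by norm_num) (by norm_num)
      have e : ∀ k : ℕ, (2⁻¹ : ℝ≥0∞) ^ k = ENNReal.ofReal ((2⁻¹ : ℝ) ^ k) := fun k => by
        rw [ENNReal.ofReal_pow (by norm_num), ENNReal.ofReal_inv_of_pos (by norm_num)]
        simp
      have h1 : Metric.ediam t ≤ (2⁻¹ : ℝ≥0∞) ^ n := by
        rw [e]; exact (ENNReal.le_ofReal_iff_toReal_le hfin (by positivity)).2 hn2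
      have h3 : (2⁻¹ : ℝ≥0∞) ^ n ≤ 2 * Metric.ediam t := by
        have : (2⁻¹ : ℝ≥0∞) ^ (n + 1) ≤ Metric.ediam t := by
          rw [e]; exact ENNReal.ofReal_le_of_le_toReal hn1.le
        calc (2⁻¹ : ℝ≥0∞) ^ n = 2 * (2⁻¹ : ℝ≥0∞) ^ (n + 1) := by
              rw [pow_succ', ← mul_assoc, ENNReal.mul_inv_cancel (by simp) (by simp), one_mul]
          _ ≤ _ := by gcongr
      calc μ (t ∩ A) ≤ M * ((2⁻¹ : ℝ≥0∞) ^ n) ^ (s : ℝ) := hsub n h1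
        _ ≤ M * (2 * Metric.ediam t) ^ (s : ℝ) := by gcongr
        _ = M * 2 ^ (s : ℝ) * Metric.ediam t ^ (s : ℝ) := by
            rw [ENNReal.mul_rpow_of_nonneg _ _ hs'.le, mul_assoc]
        _ ≤ C * Metric.ediam t ^ (s : ℝ) := by gcongr; exact le_self_add
  have hle : C⁻¹ • μ.restrict A ≤ Measure.hausdorffMeasure (s : ℝ) :=
    Measure.le_hausdorffMeasure _ _ 1 one_pos fun t ht => by
      rw [Measure.smul_apply, smul_eq_mul]
      calc C⁻¹ * (μ.restrict A) t ≤ C⁻¹ * (C * Metric.ediam t ^ (s : ℝ)) := by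
            gcongr; exact key t ht
        _ = _ := by rw [← mul_assoc, ENNReal.inv_mul_cancel hC0 hCtop, one_mul]
  apply le_dimH_of_hausdorffMeasure_ne_zero
  refine (lt_of_lt_of_le ?_ (hle A)).ne'
  rw [Measure.smul_apply, smul_eq_mul, Measure.restrict_apply_self]
  exact ENNReal.mul_pos (ENNReal.inv_ne_zero.2 hCtop) hμA

/-- If the `μ ⊗ μ`-measure of the `2⁻ᵏ`-neighbourhood of the diagonal is `O(2⁻ᵏᵃ)`, then every
measurable set carrying `μ` has Hausdorff dimension at least `a`. -/
theorem le_dimH_of_prod_measure_dyadic_le {X : Type*} [EMetricSpace X] [MeasurableSpace X]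
    [BorelSpace X] [SecondCountableTopology X] (μ : Measure X) [IsFiniteMeasure μ] (hμ : μ ≠ 0)
    {K : Set X} (hK : MeasurableSet K) (hμK : μ Kᶜ = 0) {a : ℝ≥0} {C : ℝ≥0∞} (hC : C ≠ ∞)
    (h : ∀ k : ℕ, (μ.prod μ) {p : X × X | edist p.1 p.2 ≤ (2⁻¹ : ℝ≥0∞) ^ k} ≤
      C * ((2⁻¹ : ℝ≥0∞) ^ k) ^ (a : ℝ)) :
    (a : ℝ≥0∞) ≤ dimH K := by
  refine le_of_forall_lt fun b hb => ?_
  obtain ⟨s, hbs, hsa⟩ := ENNReal.lt_iff_exists_nnreal_btwn.1 hb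
  refine hbs.trans_le ?_
  have hs : 0 < s := by exact_mod_cast (zero_le.trans_lt hbs)
  replace hsa : (s : ℝ) < a := by exact_mod_cast hsa
  have hw0 : ∀ (r : ℝ) (k : ℕ), ((2⁻¹ : ℝ≥0∞) ^ k) ^ r ≠ 0 := fun r k =>
    (ENNReal.rpow_pos (by simp [pos_iff_ne_zero]) (by finiteness)).ne'
  have hwtop : ∀ (k : ℕ), ((2⁻¹ : ℝ≥0∞) ^ k) ^ (s : ℝ) ≠ ∞ := fun k =>
    ENNReal.rpow_ne_top_of_nonneg s.2 (by finiteness)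
  have hE : ∀ k : ℕ, MeasurableSet {p : X × X | edist p.1 p.2 ≤ (2⁻¹ : ℝ≥0∞) ^ k} := fun k =>
    measurableSet_le (measurable_fst.edist measurable_snd) measurable_const
  set f : ℕ → X → ℝ≥0∞ := fun k x =>
    (((2⁻¹ : ℝ≥0∞) ^ k) ^ (s : ℝ))⁻¹ * μ {y | edist x y ≤ (2⁻¹ : ℝ≥0∞) ^ k} with hf
  have hfm : ∀ k, Measurable (f k) := fun k =>
    (measurable_measure_prodMk_left (hE k)).const_mul _
  have hint : ∫⁻ x, ∑' k, f k x ∂μ ≠ ∞ := by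
    rw [lintegral_tsum fun k => (hfm k).aemeasurable]
    refine ne_top_of_le_ne_top (b := ∑' k : ℕ, C * ((2⁻¹ : ℝ≥0∞) ^ ((a : ℝ) - s)) ^ k) ?_ ?_
    · rw [ENNReal.tsum_mul_left, ENNReal.tsum_geometric]
      refine ENNReal.mul_ne_top hC (ENNReal.inv_ne_top.2 (tsub_pos_of_lt ?_).ne')
      exact ENNReal.rpow_lt_one (by norm_num) (sub_pos.2 hsa)
    · refine ENNReal.tsum_le_tsum fun k => ?_
      have e : ∫⁻ x, f k x ∂μ = (((2⁻¹ : ℝ≥0∞) ^ k) ^ (s : ℝ))⁻¹ *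
          (μ.prod μ) {p : X × X | edist p.1 p.2 ≤ (2⁻¹ : ℝ≥0∞) ^ k} := by
        rw [Measure.prod_apply (hE k),
          ← lintegral_const_mul _ (measurable_measure_prodMk_left (hE k))]
        rfl
      rw [e]
      calc _ ≤ (((2⁻¹ : ℝ≥0∞) ^ k) ^ (s : ℝ))⁻¹ * (C * ((2⁻¹ : ℝ≥0∞) ^ k) ^ (a : ℝ)) := by
            gcongr; exact h k
        _ = C * ((2⁻¹ : ℝ≥0∞) ^ k) ^ ((a : ℝ) - s) := by
            rw [ENNReal.rpow_sub _ _ (by simp) (by finiteness), div_eq_mul_inv]; ring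
        _ = _ := by
            rw [← ENNReal.rpow_natCast, ← ENNReal.rpow_natCast, ← ENNReal.rpow_mul,
              ← ENNReal.rpow_mul, mul_comm (k : ℝ)]
  have hgm : Measurable fun x => ∑' k, f k x := Measurable.tsum hfm
  have hae := ae_lt_top hgm hint
  set A : ℕ → Set X := fun m => K ∩ {x | ∑' k, f k x ≤ m} with hA
  have hAm : ∀ m, MeasurableSet (A m) := fun m => hK.inter (measurableSet_le hgm measurable_const)
  obtain ⟨m, hm⟩ : ∃ m, μ (A m) ≠ 0 := by
    by_contra! hall
    have h0 : μ (⋃ m, A m) = 0 := measure_iUnion_null hall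
    refine hμ (Measure.measure_univ_eq_zero.1 ?_)
    have hKae : ∀ᵐ x ∂μ, x ∈ K := hμK
    refine measure_eq_zero_iff_ae_notMem.2 ?_
    filter_upwards [hae, hKae, measure_eq_zero_iff_ae_notMem.1 h0] with x hx hxK hxA
    obtain ⟨m, hm⟩ := ENNReal.exists_nat_gt hx.ne
    exact (hxA (Set.mem_iUnion_of_mem m ⟨hxK, hm.le⟩)).elim
  refine (le_dimH_of_measure_dyadic_ball_le μ (hAm m) hm hs (ENNReal.natCast_ne_top m) ?_).trans
    (dimH_mono Set.inter_subset_left)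
  intro x hx k
  have h1 : f k x ≤ m := (ENNReal.le_tsum k).trans hx.2
  calc _ = ((2⁻¹ : ℝ≥0∞) ^ k) ^ (s : ℝ) * f k x := by
        simp only [hf]
        rw [← mul_assoc, ENNReal.mul_inv_cancel (hw0 _ k) (hwtop k), one_mul]
    _ ≤ ((2⁻¹ : ℝ≥0∞) ^ k) ^ (s : ℝ) * m := by gcongr
    _ = _ := mul_comm _ _

theorem norm_fourier_sub_one_le (n : ℤ) (z : AddCircle (2 * Real.pi)) :
    ‖(fourier n z : ℂ) - 1‖ ≤ |(n : ℝ)| * ‖z‖ := by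
  induction z using QuotientAddGroup.induction_on with | _ x
  have hper : (x : AddCircle (2 * Real.pi)) =
      ((x - round ((2 * Real.pi)⁻¹ * x) * (2 * Real.pi) : ℝ) : AddCircle (2 * Real.pi)) := by
    rw [AddCircle.coe_sub, ← zsmul_eq_mul, AddCircle.coe_zsmul, AddCircle.coe_period]
    simp
  have hnorm : ‖(x : AddCircle (2 * Real.pi))‖ =
      |x - round ((2 * Real.pi)⁻¹ * x) * (2 * Real.pi)| := AddCircle.norm_eq _
  change ‖(fourier n (x : AddCircle (2 * Real.pi)) : ℂ) - 1‖ ≤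
    |(n : ℝ)| * ‖(x : AddCircle (2 * Real.pi))‖
  rw [hnorm, hper]
  set t : ℝ := x - round ((2 * Real.pi)⁻¹ * x) * (2 * Real.pi)
  have e : (fourier n (t : AddCircle (2 * Real.pi)) : ℂ) = exp (I * ((n * t : ℝ) : ℂ)) := by
    rw [fourier_coe_apply]
    congr 1
    have : (Real.pi : ℂ) ≠ 0 := by exact_mod_cast Real.pi_ne_zero
    push_cast
    field_simp
  rw [e, ← abs_mul, ← Real.norm_eq_abs]
  exact Real.norm_exp_I_mul_ofReal_sub_one_le

theorem half_le_norm_sum_fourier {N : ℕ} {z : AddCircle (2 * Real.pi)} (hz : N * ‖z‖ ≤ 1 / 2) :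
    (N : ℝ) / 2 ≤ ‖∑ j ∈ Finset.range N, (fourier (j : ℤ) z : ℂ)‖ := by
  have h1 : ‖(N : ℂ) - ∑ j ∈ Finset.range N, (fourier (j : ℤ) z : ℂ)‖ ≤ N / 2 := by
    have : (N : ℂ) - ∑ j ∈ Finset.range N, (fourier (j : ℤ) z : ℂ) =
        ∑ j ∈ Finset.range N, (1 - (fourier (j : ℤ) z : ℂ)) := by simp
    rw [this]
    refine (norm_sum_le_of_le (n := fun _ => (1 / 2 : ℝ)) _ fun j hj => ?_).trans
      (by simp [div_eq_mul_inv])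
    rw [norm_sub_rev]
    refine (norm_fourier_sub_one_le _ _).trans (le_trans ?_ hz)
    have : (j : ℝ) ≤ N := by exact_mod_cast (Finset.mem_range.1 hj).le
    simp only [Int.cast_natCast, Nat.abs_cast]
    gcongr
  have h2 := norm_sub_norm_le (N : ℂ) (∑ j ∈ Finset.range N, (fourier (j : ℤ) z : ℂ))
  rw [Complex.norm_natCast] at h2
  linarith

theorem fourier_sub_apply {T : ℝ} (n : ℤ) (x y : AddCircle T) :
    (fourier n (x - y) : ℂ) = fourier n x * fourier (-n) y := by
  simp [fourier_apply, sub_eq_add_neg, AddCircle.toCircle_add, AddCircle.toCircle_neg]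

section

variable (μ : Measure (AddCircle (2 * Real.pi)))

theorem measureFourierCoeff_neg (n : ℤ) :
    measureFourierCoeff μ (-n) = starRingEnd ℂ (measureFourierCoeff μ n) := by
  simp only [measureFourierCoeff, ← integral_conj, fourier_neg, neg_neg, Complex.conj_conj]

theorem norm_measureFourierCoeff_zero [IsProbabilityMeasure μ] :
    ‖measureFourierCoeff μ 0‖ = 1 := by
  simp [measureFourierCoeff]

theorem integral_prod_norm_sum_fourier_sq [IsFiniteMeasure μ] (N : ℕ) :
    ∫ p, ‖∑ j ∈ Finset.range N, (fourier (j : ℤ) (p.1 - p.2) : ℂ)‖ ^ 2 ∂(μ.prod μ) =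
      ∑ j ∈ Finset.range N, ∑ k ∈ Finset.range N,
        ‖measureFourierCoeff μ ((j : ℤ) - k)‖ ^ 2 := by
  have hint : ∀ m : ℤ, Integrable (fun p : AddCircle (2 * Real.pi) × AddCircle (2 * Real.pi) =>
      (fourier m p.1 * fourier (-m) p.2 : ℂ)) (μ.prod μ) := fun m => by
    refine Integrable.of_bound (C := 1) (by fun_prop) (ae_of_all _ fun p => ?_)
    simp [fourier_apply, Circle.norm_coe]
  have hpt : ∀ p : AddCircle (2 * Real.pi) × AddCircle (2 * Real.pi),
      ((‖∑ j ∈ Finset.range N, (fourier (j : ℤ) (p.1 - p.2) : ℂ)‖ ^ 2 : ℝ) : ℂ) =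
      ∑ j ∈ Finset.range N, ∑ k ∈ Finset.range N,
        (fourier ((j : ℤ) - k) p.1 * fourier (-((j : ℤ) - k)) p.2 : ℂ) := fun p => by
    rw [Complex.ofReal_pow, ← Complex.mul_conj', map_sum, Finset.sum_mul_sum]
    refine Finset.sum_congr rfl fun j _ => Finset.sum_congr rfl fun k _ => ?_
    rw [← fourier_neg, ← fourier_add, ← sub_eq_add_neg, fourier_sub_apply]
  apply Complex.ofReal_injective
  rw [← integral_complex_ofReal, integral_congr_ae (ae_of_all _ hpt),
    integral_finsetSum _ fun j _ => integrable_finsetSum _ fun k _ => hint _]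
  push_cast
  refine Finset.sum_congr rfl fun j _ => ?_
  rw [integral_finsetSum _ fun k _ => hint _]
  refine Finset.sum_congr rfl fun k _ => ?_
  rw [integral_prod_mul, ← Complex.conj_mul', ← measureFourierCoeff_neg]
  simp [measureFourierCoeff]

variable [IsProbabilityMeasure μ] {a : ℝ}

theorem sum_norm_measureFourierCoeff_sq_le (ha1 : a < 1)
    (hsum : Summable fun n : ℤ =>
      if n = 0 then (0 : ℝ) else ‖measureFourierCoeff μ n‖ ^ 2 / (|n| : ℝ) ^ (1 - a)) (N j : ℕ)
    (hj : j < N) :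
    ∑ k ∈ Finset.range N, ‖measureFourierCoeff μ ((j : ℤ) - k)‖ ^ 2 ≤
      1 + (N : ℝ) ^ (1 - a) * ∑' n : ℤ,
        if n = 0 then (0 : ℝ) else ‖measureFourierCoeff μ n‖ ^ 2 / (|n| : ℝ) ^ (1 - a) := by
  set g : ℤ → ℝ := fun n =>
    if n = 0 then (0 : ℝ) else ‖measureFourierCoeff μ n‖ ^ 2 / (|n| : ℝ) ^ (1 - a) with hg
  have hg0 : ∀ n, 0 ≤ g n := fun n => by simp only [hg]; split_ifs <;> positivity
  have hterm : ∀ k ∈ Finset.range N, ‖measureFourierCoeff μ ((j : ℤ) - k)‖ ^ 2 ≤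
      (if j = k then 1 else 0) + (N : ℝ) ^ (1 - a) * g ((j : ℤ) - k) := fun k hk => by
    by_cases hjk : j = k
    · subst hjk
      simp [hg, norm_measureFourierCoeff_zero]
    · have hne : (j : ℤ) - k ≠ 0 := by omega
      have hpos : (0 : ℝ) < |(((j : ℤ) - k : ℤ) : ℝ)| := abs_pos.2 (by exact_mod_cast hne)
      have hle : |(((j : ℤ) - k : ℤ) : ℝ)| ≤ N := by
        have : |(j : ℤ) - k| ≤ N := by
          have := Finset.mem_range.1 hk
          rw [abs_le]; omega
        exact_mod_cast this
      simp only [hjk, if_false, zero_add, hg, hne]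
      rw [mul_div_left_comm]
      refine le_mul_of_one_le_right (by positivity) ?_
      rw [one_le_div (by positivity)]
      exact Real.rpow_le_rpow hpos.le hle (by linarith)
  refine (Finset.sum_le_sum hterm).trans ?_
  rw [Finset.sum_add_distrib, ← Finset.mul_sum]
  have hinj : Function.Injective fun k : ℕ => (j : ℤ) - k := fun k l h => by
    simp only at h; omega
  gcongr
  · simp [hj]
  · exact ((hsum.comp_injective hinj).sum_le_tsum _ fun k _ => hg0 _).trans
      (tsum_comp_le_tsum_of_inj hsum hg0 hinj)

theorem prod_measureReal_near_diagonal_le (ha1 : a < 1)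
    (hsum : Summable fun n : ℤ =>
      if n = 0 then (0 : ℝ) else ‖measureFourierCoeff μ n‖ ^ 2 / (|n| : ℝ) ^ (1 - a)) {N : ℕ}
    (hN : 0 < N) :
    (μ.prod μ).real {p | N * ‖p.1 - p.2‖ ≤ 1 / 2} ≤
      4 * (1 + ∑' n : ℤ, if n = 0 then (0 : ℝ) else
        ‖measureFourierCoeff μ n‖ ^ 2 / (|n| : ℝ) ^ (1 - a)) * (N : ℝ) ^ (-a) := by
  set S := ∑' n : ℤ, if n = 0 then (0 : ℝ) else
    ‖measureFourierCoeff μ n‖ ^ 2 / (|n| : ℝ) ^ (1 - a) with hS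
  have hN0 : (0 : ℝ) < N := by exact_mod_cast hN
  have hN1 : (1 : ℝ) ≤ N := by exact_mod_cast hN
  have hint : Integrable (fun p : AddCircle (2 * Real.pi) × AddCircle (2 * Real.pi) =>
      ‖∑ j ∈ Finset.range N, (fourier (j : ℤ) (p.1 - p.2) : ℂ)‖ ^ 2) (μ.prod μ) := by
    refine Integrable.of_bound (C := (N : ℝ) ^ 2) (by fun_prop) (ae_of_all _ fun p => ?_)
    rw [Real.norm_of_nonneg (by positivity)]
    gcongr
    refine (norm_sum_le_of_le (n := fun _ => (1 : ℝ)) _ fun j _ => ?_).trans (by simp)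
    simp [fourier_apply, Circle.norm_coe]
  have hmarkov := mul_meas_ge_le_integral_of_nonneg (ae_of_all _ fun p => by positivity) hint
    (((N : ℝ) / 2) ^ 2)
  rw [integral_prod_norm_sum_fourier_sq] at hmarkov
  have hsub : (μ.prod μ).real {p | N * ‖p.1 - p.2‖ ≤ 1 / 2} ≤ (μ.prod μ).real
      {p | ((N : ℝ) / 2) ^ 2 ≤ ‖∑ j ∈ Finset.range N, (fourier (j : ℤ) (p.1 - p.2) : ℂ)‖ ^ 2} :=
    measureReal_mono fun p hp => by
      have := half_le_norm_sum_fourier hp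
      simp only [Set.mem_ofPred_eq]
      gcongr
  have hbound : ∑ j ∈ Finset.range N, ∑ k ∈ Finset.range N,
      ‖measureFourierCoeff μ ((j : ℤ) - k)‖ ^ 2 ≤ N * ((N : ℝ) ^ (1 - a) * (1 + S)) := by
    refine (Finset.sum_le_sum fun j hj => sum_norm_measureFourierCoeff_sq_le μ ha1 hsum N j
      (Finset.mem_range.1 hj)).trans ?_
    rw [Finset.sum_const, Finset.card_range, nsmul_eq_mul, mul_add _ 1 S, mul_one]
    gcongr
    exact Real.one_le_rpow hN1 (by linarith)
  have hpow : (N : ℝ) ^ (1 - a) = N * (N : ℝ) ^ (-a) := by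
    rw [sub_eq_add_neg, Real.rpow_add hN0, Real.rpow_one]
  rw [hpow] at hbound
  have hfinal := ((mul_le_mul_of_nonneg_left hsub (by positivity)).trans hmarkov).trans hbound
  refine le_of_mul_le_mul_left (hfinal.trans_eq ?_) (by positivity : (0 : ℝ) < ((N : ℝ) / 2) ^ 2)
  ring

end

/-- Frostman's theorem, first half: if a compact set `K` in the circle supports a
probability measure `μ` with `∑_{n ≠ 0} |μ̂(n)|² / |n|^{1-a} < ∞` for some `0 < a < 1`,
then `dimH K ≥ a`. -/
theorem frostman_first_half (a : ℝ) (ha : 0 < a) (ha1 : a < 1)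
    (K : Set (AddCircle (2 * Real.pi))) (hK : IsCompact K)
    (μ : Measure (AddCircle (2 * Real.pi))) [IsProbabilityMeasure μ]
    (hsupp : μ Kᶜ = 0)
    (hsum : Summable fun n : ℤ =>
      if n = 0 then (0 : ℝ) else ‖measureFourierCoeff μ n‖ ^ 2 / (|n| : ℝ) ^ (1 - a)) :
    ENNReal.ofReal a ≤ dimH K := by
  set S := ∑' n : ℤ, if n = 0 then (0 : ℝ) else
    ‖measureFourierCoeff μ n‖ ^ 2 / (|n| : ℝ) ^ (1 - a) with hS
  have hS0 : 0 ≤ S := tsum_nonneg fun n => by split_ifs <;> positivity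
  have hpow1 : (1 : ℝ) ≤ 2 ^ a := Real.one_le_rpow one_le_two ha.le
  refine le_dimH_of_prod_measure_dyadic_le μ (IsProbabilityMeasure.ne_zero μ) hK.measurableSet
    hsupp (a := a.toNNReal) (C := ENNReal.ofReal (4 * (1 + S) * 2 ^ a)) ENNReal.ofReal_ne_top
    fun k => ?_
  rw [Real.coe_toNNReal a ha.le]
  have e : (2⁻¹ : ℝ≥0∞) ^ k = ENNReal.ofReal ((2⁻¹ : ℝ) ^ k) := by
    rw [ENNReal.ofReal_pow (by norm_num), ENNReal.ofReal_inv_of_pos (by norm_num)]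
    simp
  rw [e, ENNReal.ofReal_rpow_of_pos (by positivity), ← ENNReal.ofReal_mul (by positivity),
    ← ofReal_measureReal]
  refine ENNReal.ofReal_le_ofReal ?_
  cases k with
  | zero =>
    refine measureReal_le_one.trans ?_
    simp only [pow_zero, Real.one_rpow, mul_one]
    nlinarith
  | succ k =>
    have hr : (((2 ^ k : ℕ) : ℝ)) ^ (-a) = 2 ^ a * ((2⁻¹ : ℝ) ^ (k + 1)) ^ a := by
      rw [← Real.mul_rpow (by positivity) (by positivity), Real.rpow_neg (by positivity),
        ← Real.inv_rpow (by positivity)]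
      congr 1
      push_cast
      rw [pow_succ', mul_inv_cancel_left₀ (by norm_num), inv_pow]
    have hmain := prod_measureReal_near_diagonal_le μ ha1 hsum (N := 2 ^ k) (by positivity)
    rw [hr, ← mul_assoc] at hmain
    refine (measureReal_mono fun p hp => ?_).trans hmain
    simp only [Set.mem_ofPred_eq] at hp ⊢
    rw [edist_dist, ENNReal.ofReal_le_ofReal_iff (by positivity), dist_eq_norm] at hp
    calc ((2 ^ k : ℕ) : ℝ) * ‖p.1 - p.2‖ ≤ ((2 ^ k : ℕ) : ℝ) * 2⁻¹ ^ (k + 1) := by gcongr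
      _ = 1 / 2 := by
        push_cast
        rw [pow_succ, ← mul_assoc, ← mul_pow]
        norm_num
end

section
/- If a compact set K in the circle has Hausdorff dimension strictly greater than a (with 0 < a < 1), then K supports a probability measure μ satisfying ∑_{n≠0} |μ̂(n)|²/|n|^{1-a} < ∞. -/
open MeasureTheory Complex

/-- The `d`-dimensional Hausdorff content `H^d_∞`. -/
noncomputable def hausdorffContent (X : Type*) [PseudoEMetricSpace X] (d : ℝ) (hd : 0 < d) :
    OuterMeasure X :=
  OuterMeasure.ofFunction (fun s => Metric.ediam s ^ d) (by simp [hd])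

lemma hausdorffContent_le {X : Type*} [PseudoEMetricSpace X] {d : ℝ} (hd : 0 < d) (s : Set X) :
    hausdorffContent X d hd s ≤ Metric.ediam s ^ d :=
  OuterMeasure.ofFunction_le s

lemma hausdorffMeasure_eq_zero_of_hausdorffContent_eq_zero {X : Type*} [EMetricSpace X]
    [MeasurableSpace X] [BorelSpace X] {d : ℝ} (hd : 0 < d) {s : Set X}
    (h : hausdorffContent X d hd s = 0) : Measure.hausdorffMeasure d s = 0 := by
  rw [Measure.hausdorffMeasure_apply, ← nonpos_iff_eq_zero]
  refine iSup₂_le fun r hr => le_of_forall_gt fun δ hδ => ?_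
  have hε : hausdorffContent X d hd s < min δ (r ^ d) := by
    rw [h]
    exact lt_min hδ (by
      rcases eq_or_ne r ⊤ with rfl | hr'
      · simp [hd]
      · exact ENNReal.rpow_pos hr hr')
  rw [hausdorffContent, OuterMeasure.ofFunction_apply] at hε
  simp only [iInf_lt_iff] at hε ⊢
  obtain ⟨t, hst, ht⟩ := hε
  refine ⟨t, hst, fun n => ?_, lt_of_le_of_lt ?_ (ht.trans_le (min_le_left _ _))⟩
  · exact (ENNReal.rpow_le_rpow_iff hd).1
      ((ENNReal.le_tsum n).trans (ht.le.trans (min_le_right _ _)))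
  · exact ENNReal.tsum_le_tsum fun n => iSup_le fun _ => le_rfl

/-- Frostman's lemma on the circle. The measure is the push-forward of the Stieltjes measure of
`x ↦ H^d_∞(K ∩ [0, x])`, which is `d`-Hölder by subadditivity of the content. -/
lemma exists_frostman_measure {T : ℝ} [hT : Fact (0 < T)] {d : ℝ} (hd : 0 < d)
    {K : Set (AddCircle T)} (hK : IsClosed K) (hpos : Measure.hausdorffMeasure d K ≠ 0) :
    ∃ μ : Measure (AddCircle T), IsProbabilityMeasure μ ∧ μ Kᶜ = 0 ∧
      ∃ C : ℝ, ∀ (x : AddCircle T) (r : ℝ), 0 < r →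
        μ.real (Metric.closedBall x r) ≤ C * r ^ d := by
  have hT0 : 0 < T := hT.out
  set E := hausdorffContent (AddCircle T) d hd
  set q : ℝ → AddCircle T := fun t => (t : AddCircle T) with hq
  have hqm : Measurable q := (AddCircle.continuous_mk' T).measurable
  have hqlip : ∀ x y : ℝ, edist (q x) (q y) ≤ edist x y := by
    intro x y
    rw [edist_dist, edist_dist, dist_eq_norm, dist_eq_norm]
    refine ENNReal.ofReal_le_ofReal ?_
    rw [hq]
    simp only [← AddCircle.coe_sub]
    exact QuotientAddGroup.norm_mk_le_norm
  have hEI : ∀ x y : ℝ, x ≤ y → E (q '' Set.Icc x y) ≤ ENNReal.ofReal ((y - x) ^ d) := by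
    intro x y hxy
    refine (hausdorffContent_le hd _).trans ?_
    rw [← ENNReal.ofReal_rpow_of_nonneg (sub_nonneg.2 hxy) hd.le]
    refine ENNReal.rpow_le_rpow (Metric.ediam_le ?_) hd.le
    rintro _ ⟨s, hs, rfl⟩ _ ⟨t, ht, rfl⟩
    refine (hqlip s t).trans ?_
    rw [edist_dist]
    exact ENNReal.ofReal_le_ofReal (Real.dist_le_of_mem_Icc hs ht)
  set F : ℝ → ENNReal := fun x => E (K ∩ q '' Set.Icc 0 x) with hF
  have hFmono : Monotone F := fun x y hxy => by
    refine measure_mono (Set.inter_subset_inter_right _ (Set.image_mono ?_))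
    exact Set.Icc_subset_Icc_right hxy
  have hFfin : ∀ x, F x ≠ ⊤ := by
    intro x
    have h1 : F x ≤ F (max 0 x) := hFmono (le_max_right _ _)
    refine ne_top_of_le_ne_top ENNReal.ofReal_ne_top (h1.trans <|
      (measure_mono Set.inter_subset_right).trans (hEI 0 (max 0 x) (le_max_left _ _)))
  have hFsub : ∀ x y : ℝ, x ≤ y → F y ≤ F x + E (K ∩ q '' Set.Icc x y) := by
    intro x y hxy
    refine (measure_mono ?_).trans (measure_union_le _ _)
    rintro _ ⟨hk, s, hs, rfl⟩
    rcases le_total s x with h | h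
    · exact Or.inl ⟨hk, s, ⟨hs.1, h⟩, rfl⟩
    · exact Or.inr ⟨hk, s, ⟨h, hs.2⟩, rfl⟩
  have hhmono : Monotone fun x => (F x).toReal := fun x y hxy =>
    ENNReal.toReal_mono (hFfin y) (hFmono hxy)
  have hhold : ∀ x y : ℝ, x ≤ y → (F y).toReal - (F x).toReal ≤ (y - x) ^ d := by
    intro x y hxy
    have h1 : F y ≤ F x + ENNReal.ofReal ((y - x) ^ d) :=
      (hFsub x y hxy).trans (by
        gcongr
        exact (measure_mono Set.inter_subset_right).trans (hEI x y hxy))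
    have h2 := ENNReal.toReal_mono (by simp [hFfin]) h1
    rw [ENNReal.toReal_add (hFfin x) ENNReal.ofReal_ne_top, ENNReal.toReal_ofReal
      (Real.rpow_nonneg (sub_nonneg.2 hxy) d)] at h2
    linarith
  let h : StieltjesFunction ℝ :=
    { toFun := fun x => (F x).toReal
      mono' := hhmono
      right_continuous' := by
        intro x
        have hlim : Filter.Tendsto (fun y : ℝ => (F x).toReal + (y - x) ^ d)
            (nhdsWithin x (Set.Ici x)) (nhds ((F x).toReal)) := by
          have : ContinuousAt (fun y : ℝ => (F x).toReal + (y - x) ^ d) x :=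
            continuousAt_const.add
              ((continuousAt_id.sub continuousAt_const).rpow_const (Or.inr hd.le))
          have h2 := this.tendsto.mono_left (nhdsWithin_le_nhds (s := Set.Ici x))
          simpa [Real.zero_rpow hd.ne'] using h2
        refine tendsto_of_tendsto_of_tendsto_of_le_of_le' tendsto_const_nhds hlim ?_ ?_
        · filter_upwards [self_mem_nhdsWithin] with y hy using hhmono hy
        · filter_upwards [self_mem_nhdsWithin] with y hy
          linarith [hhold x y hy] }
  have hIoc : ∀ x y, h.measure (Set.Ioc x y) = ENNReal.ofReal ((F y).toReal - (F x).toReal) :=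
    fun x y => h.measure_Ioc x y
  have hF0 : F 0 = 0 := by
    refine le_antisymm ?_ zero_le
    have := (measure_mono (μ := E) (s := K ∩ q '' Set.Icc 0 0) Set.inter_subset_right).trans
      (hEI 0 0 le_rfl)
    simpa [hF, Real.zero_rpow hd.ne'] using this
  have hFT : F T = E K := by
    have : q '' Set.Icc 0 T = Set.univ := by
      simpa using AddCircle.coe_image_Icc_eq T 0
    simp [hF, this]
  have hEK : E K ≠ 0 := fun h0 => hpos (hausdorffMeasure_eq_zero_of_hausdorffContent_eq_zero hd h0)
  set ν := (h.measure.restrict (Set.Ioc 0 T)).map q with hν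
  have hνuniv : ν Set.univ = E K := by
    rw [hν, Measure.map_apply hqm MeasurableSet.univ, Set.preimage_univ, Measure.restrict_apply_univ,
      hIoc, hF0, hFT]
    simp [← hFT, hFfin]
  have hνK : ν Kᶜ = 0 := by
    rw [hν, Measure.map_apply hqm hK.measurableSet.compl]
    refine le_antisymm ((Measure.restrict_apply_le _ _).trans (le_of_eq ?_)) zero_le
    refine measure_null_of_locally_null _ fun x hx => ?_
    have hopen : IsOpen (q ⁻¹' Kᶜ) := hK.isOpen_compl.preimage (AddCircle.continuous_mk' T)
    obtain ⟨ε, hε, hball⟩ := Metric.isOpen_iff.1 hopen x hx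
    refine ⟨Set.Ioc (x - ε / 2) (x + ε / 2), mem_nhdsWithin_of_mem_nhds
      (Ioc_mem_nhds (by linarith) (by linarith)), ?_⟩
    rw [hIoc, ENNReal.ofReal_eq_zero, sub_nonpos]
    refine ENNReal.toReal_mono (hFfin _) ?_
    have hempty : K ∩ q '' Set.Icc (x - ε / 2) (x + ε / 2) = ∅ := by
      refine Set.eq_empty_of_forall_notMem ?_
      rintro _ ⟨hk, s, hs, rfl⟩
      refine hball (?_ : s ∈ Metric.ball x ε) hk
      rw [Metric.mem_ball, Real.dist_eq, abs_lt]
      constructor <;> linarith [hs.1, hs.2]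
    simpa [hempty] using hFsub (x - ε / 2) (x + ε / 2) (by linarith)
  have hνball : ∀ (x : AddCircle T) (r : ℝ), 0 < r →
      ν (Metric.closedBall x r) ≤ ENNReal.ofReal (3 * 3 ^ d * r ^ d) := by
    intro x r hr
    obtain ⟨t, ht, rfl⟩ : ∃ t ∈ Set.Icc 0 T, q t = x := by
      have := AddCircle.coe_image_Icc_eq T 0
      rw [zero_add] at this
      exact this.ge (Set.mem_univ x)
    rw [hν, Measure.map_apply hqm Metric.isClosed_closedBall.measurableSet,
      Measure.restrict_apply (hqm Metric.isClosed_closedBall.measurableSet)]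
    have hsub : q ⁻¹' Metric.closedBall (q t) r ∩ Set.Ioc 0 T ⊆
        ⋃ k ∈ Finset.Icc (-1 : ℤ) 1, Set.Ioc (t + k * T - 2 * r) (t + k * T + r) := by
      rintro s ⟨hs, hs0, hsT⟩
      have hs' : ‖((s - t : ℝ) : AddCircle T)‖ ≤ r := by
        simpa [hq, dist_eq_norm] using hs
      rw [AddCircle.norm_eq] at hs'
      set k := round (T⁻¹ * (s - t))
      have hk := abs_le.1 (abs_sub_round (T⁻¹ * (s - t)))
      have h1 : T⁻¹ * (s - t) ≤ 1 := by
        rw [inv_mul_le_iff₀ hT0]; linarith [ht.1]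
      have h2 : -1 ≤ T⁻¹ * (s - t) := by
        rw [le_inv_mul_iff₀ hT0]; linarith [ht.2]
      have hk1 : k < 2 := by
        have : (k : ℝ) < 2 := by linarith [hk.1]
        exact_mod_cast this
      have hk2 : -2 < k := by
        have : (-2 : ℝ) < k := by linarith [hk.2]
        exact_mod_cast this
      simp only [Set.mem_iUnion]
      have := abs_le.1 hs'
      exact ⟨k, Finset.mem_Icc.2 ⟨by omega, by omega⟩, by linarith, by linarith⟩
    refine (measure_mono hsub).trans ((measure_biUnion_finset_le _ _).trans ?_)
    calc _ ≤ ∑ k ∈ Finset.Icc (-1 : ℤ) 1, ENNReal.ofReal (3 ^ d * r ^ d) := by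
          refine Finset.sum_le_sum fun k _ => ?_
          rw [hIoc]
          refine ENNReal.ofReal_le_ofReal ((hhold _ _ (by linarith)).trans (le_of_eq ?_))
          rw [← Real.mul_rpow (by norm_num) hr.le]
          ring_nf
      _ = _ := by
          rw [Finset.sum_const, mul_assoc (3 : ℝ), ENNReal.ofReal_mul (p := 3) (by norm_num)]
          simp
  have hνtop : ν Set.univ ≠ ⊤ := by rw [hνuniv, ← hFT]; exact hFfin T
  have hνzero : ν Set.univ ≠ 0 := by rwa [hνuniv]
  refine ⟨(ν Set.univ)⁻¹ • ν, ⟨?_⟩, by simp [hνK], (ν Set.univ)⁻¹.toReal * (3 * 3 ^ d),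
    fun x r hr => ?_⟩
  · simp [ENNReal.inv_mul_cancel hνzero hνtop]
  · rw [Measure.real, Measure.smul_apply, smul_eq_mul, ENNReal.toReal_mul, mul_assoc]
    gcongr
    exact ENNReal.toReal_le_of_le_ofReal (by positivity) (hνball x r hr)

lemma summable_div_rpow_of_sum_le {u : ℤ → ℝ} (hu : ∀ n, 0 ≤ u n) {a b D : ℝ} (ha : a < 1)
    (hab : a < b)
    (h : ∀ (N : ℕ), 0 < N → ∑ n ∈ Finset.Icc (-N : ℤ) N, u n ≤ D * (N : ℝ) ^ (1 - b)) :
    Summable fun n : ℤ => if n = 0 then (0 : ℝ) else u n / (|n| : ℝ) ^ (1 - a) := by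
  have hD : 0 ≤ D := by
    have := (Finset.sum_nonneg fun n _ => hu n).trans (h 1 one_pos)
    simpa using this
  set ρ : ℝ := 2 ^ (a - b) with hρ
  have hρ0 : 0 < ρ := by positivity
  have hρ1 : ρ < 1 := Real.rpow_lt_one_of_one_lt_of_neg one_lt_two (by linarith)
  have hs : Summable fun k : ℕ => D * 2 ^ (1 - b) * ρ ^ k :=
    (summable_geometric_of_lt_one hρ0.le hρ1).mul_left _
  set t : ℤ → ℝ := fun n => if n = 0 then (0 : ℝ) else u n / (|n| : ℝ) ^ (1 - a) with ht
  have htn : ∀ n, 0 ≤ t n := fun n => by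
    simp only [ht]
    split_ifs
    · exact le_rfl
    · exact div_nonneg (hu n) (by positivity)
  refine summable_of_sum_le (c := ∑' k : ℕ, D * 2 ^ (1 - b) * ρ ^ k) htn fun s => ?_
  set g : ℤ → ℕ := fun n => Nat.log 2 n.natAbs
  rw [← Finset.sum_fiberwise_of_maps_to (g := g) (t := s.image g)
    (fun i hi => Finset.mem_image_of_mem g hi)]
  refine (Finset.sum_le_sum fun k _ => ?_).trans
    (hs.sum_le_tsum (s.image g) fun k _ => by positivity)
  have hterm : ∀ n ∈ s.filter (fun n => g n = k),
      t n ≤ (if n = 0 then 0 else u n) / ((2 : ℝ) ^ k) ^ (1 - a) := by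
    intro n hn
    simp only [ht]
    split_ifs with h0
    · simp
    · have hk : 2 ^ k ≤ n.natAbs := by
        rw [← (Finset.mem_filter.1 hn).2]
        exact Nat.pow_log_le_self 2 (by simpa using h0)
      have hk' : (2 : ℝ) ^ k ≤ |(n : ℝ)| := by
        rw [← Int.cast_abs, Int.abs_eq_natAbs]
        exact_mod_cast hk
      have := hu n
      have h1a : 0 ≤ 1 - a := by linarith
      gcongr
  refine (Finset.sum_le_sum hterm).trans ?_
  rw [← Finset.sum_div, div_le_iff₀ (by positivity)]
  have hblock : ∑ n ∈ s.filter (fun n => g n = k), (if n = 0 then 0 else u n) ≤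
      ∑ n ∈ Finset.Icc (-((2 ^ (k + 1) : ℕ) : ℤ)) ((2 ^ (k + 1) : ℕ) : ℤ), u n := by
    refine (Finset.sum_le_sum (g := u) fun n _ => ?_).trans
      (Finset.sum_le_sum_of_subset_of_nonneg ?_ fun n _ _ => hu n)
    · split_ifs
      · exact hu n
      · exact le_rfl
    · intro n hn
      have hk : n.natAbs < 2 ^ (k + 1) := by
        rw [← (Finset.mem_filter.1 hn).2]
        exact Nat.lt_pow_succ_log_self one_lt_two _
      rw [Finset.mem_Icc]
      omega
  refine hblock.trans ((h _ (by positivity)).trans (le_of_eq ?_))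
  rw [mul_assoc, mul_assoc]
  congr 1
  push_cast
  rw [hρ, ← Real.rpow_natCast, ← Real.rpow_natCast, ← Real.rpow_natCast, ← Real.rpow_mul (by norm_num),
    ← Real.rpow_mul (by norm_num), ← Real.rpow_mul (by norm_num), ← Real.rpow_add (by norm_num),
    ← Real.rpow_add (by norm_num)]
  congr 1
  push_cast
  ring

section

open AddCircle

lemma fourierCoeff_measure_closedBall {T : ℝ} [hT : Fact (0 < T)] (μ : Measure (AddCircle T))
    [IsFiniteMeasure μ] (r : ℝ) (n : ℤ) :
    fourierCoeff (fun x => (μ.real (Metric.closedBall x r) : ℂ)) n =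
      (∫ y, fourier (-n) y ∂μ) *
        ∫ x in Metric.closedBall (0 : AddCircle T) r, fourier (-n) x ∂haarAddCircle := by
  have hball : ∀ x y : AddCircle T, (Metric.closedBall x r).indicator (fun _ => fourier (-n) x) y =
      (Metric.closedBall (0 : AddCircle T) r).indicator (fun z => fourier (-n) (z + y)) (x - y) := by
    intro x y
    simp only [Set.indicator, Metric.mem_closedBall, dist_eq_norm, sub_zero, sub_add_cancel,
      norm_sub_rev x y]
  have hmeas : MeasurableSet {p : AddCircle T × AddCircle T | dist p.2 p.1 ≤ r} :=
    (isClosed_le (continuous_snd.dist continuous_fst) continuous_const).measurableSet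
  calc fourierCoeff (fun x => (μ.real (Metric.closedBall x r) : ℂ)) n
      = ∫ x, ∫ y, (Metric.closedBall x r).indicator (fun _ => fourier (-n) x) y ∂μ
          ∂haarAddCircle := by
        rw [fourierCoeff]
        congr 1 with x
        rw [integral_indicator Metric.isClosed_closedBall.measurableSet, setIntegral_const]
        simp [mul_comm]
    _ = ∫ y, ∫ x, (Metric.closedBall x r).indicator (fun _ => fourier (-n) x) y ∂haarAddCircle
          ∂μ := by
        refine integral_integral_swap ?_
        have : Integrable (fun p : AddCircle T × AddCircle T => fourier (-n) p.1)
            (haarAddCircle.prod μ) :=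
          Integrable.of_bound ((map_continuous (fourier (-n))).comp continuous_fst).aestronglyMeasurable
            1 (.of_forall fun _ => (Circle.norm_coe _).le)
        exact this.indicator hmeas
    _ = ∫ y, fourier (-n) y * ∫ x in Metric.closedBall (0 : AddCircle T) r, fourier (-n) x ∂haarAddCircle ∂μ := by
        congr 1 with y
        simp_rw [hball]
        rw [integral_sub_right_eq_self
          (fun x => (Metric.closedBall (0 : AddCircle T) r).indicator
            (fun z => fourier (-n) (z + y)) x),
          integral_indicator Metric.isClosed_closedBall.measurableSet, ← integral_const_mul]
        congr 1 with x
        change fourier (-n) (x + y) = fourier (-n) y * fourier (-n) x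
        rw [fourier_apply, fourier_apply, fourier_apply, smul_add, AddCircle.toCircle_add,
          Circle.coe_mul, mul_comm]
    _ = _ := integral_mul_const _ _

lemma half_le_norm_setIntegral_fourier {T : ℝ} [hT : Fact (0 < T)] {r : ℝ} {n : ℤ}
    (hn : 2 * Real.pi * |(n : ℝ)| * r ≤ T) :
    haarAddCircle.real (Metric.closedBall (0 : AddCircle T) r) / 2 ≤
      ‖∫ x in Metric.closedBall (0 : AddCircle T) r, fourier n x ∂haarAddCircle‖ := by
  have hT0 : 0 < T := hT.out
  have hintegral : ∀ s : Set (AddCircle T), IntegrableOn (fun x => fourier n x) s haarAddCircle :=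
    fun s => (Integrable.of_bound (map_continuous (fourier n)).aestronglyMeasurable
      1 (.of_forall fun _ => (Circle.norm_coe _).le)).integrableOn
  refine le_trans ?_ (Complex.abs_re_le_norm _ |>.trans' (le_abs_self _))
  rw [← RCLike.re_eq_complex_re, ← integral_re (hintegral _), div_eq_mul_inv, ← smul_eq_mul,
    ← setIntegral_const]
  refine setIntegral_mono_on (integrable_const _).integrableOn (hintegral _).re
    Metric.isClosed_closedBall.measurableSet fun x hx => ?_
  induction x using QuotientAddGroup.induction_on with | H t =>
  rw [mem_closedBall_zero_iff] at hx
  change ‖(t : AddCircle T)‖ ≤ r at hx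
  set s := t - round (T⁻¹ * t) * T with hs
  have hst : (t : AddCircle T) = (s : AddCircle T) := by
    rw [hs, AddCircle.coe_sub, ← zsmul_eq_mul, AddCircle.coe_zsmul, AddCircle.coe_period, smul_zero,
      sub_zero]
  rw [AddCircle.norm_eq] at hx
  change _ ≤ RCLike.re (fourier n (t : AddCircle T))
  rw [hst, fourier_coe_apply]
  have : 2 * (Real.pi : ℂ) * I * n * s / T = ((2 * Real.pi * n * s / T : ℝ) : ℂ) * I := by
    push_cast; ring
  rw [this, RCLike.re_eq_complex_re, exp_ofReal_mul_I_re]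
  refine le_trans ?_ Real.one_sub_sq_div_two_le_cos
  have habs : |2 * Real.pi * n * s / T| ≤ 1 := by
    rw [abs_div, abs_mul, abs_mul, abs_of_pos hT0, abs_of_pos Real.two_pi_pos, div_le_one hT0]
    refine le_trans ?_ hn
    have := Real.pi_pos
    gcongr
  have := (sq_le_one_iff_abs_le_one _).2 habs
  linarith

lemma sum_sq_norm_fourier_le {T : ℝ} [hT : Fact (0 < T)] (μ : Measure (AddCircle T))
    [IsProbabilityMeasure μ] {C b : ℝ}
    (hμ : ∀ (x : AddCircle T) (r : ℝ), 0 < r → μ.real (Metric.closedBall x r) ≤ C * r ^ b)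
    (N : ℕ) (hN : 0 < N) :
    ∑ n ∈ Finset.Icc (-N : ℤ) N, ‖∫ x, fourier (-n) x ∂μ‖ ^ 2 ≤
      4 * Real.pi * C * (T / (2 * Real.pi)) ^ b * (N : ℝ) ^ (1 - b) := by
  have hT0 : 0 < T := hT.out
  have hpi := Real.pi_pos
  have hN' : (1 : ℝ) ≤ N := by exact_mod_cast hN
  set r : ℝ := T / (2 * Real.pi) / N with hr
  have hr0 : 0 < r := by positivity
  set m := haarAddCircle.real (Metric.closedBall (0 : AddCircle T) r) with hm
  have hmval : m = 1 / (Real.pi * N) := by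
    have h1 := AddCircle.volume_closedBall T (x := 0) r
    rw [AddCircle.volume_eq_smul_haarAddCircle, Measure.smul_apply, smul_eq_mul,
      min_eq_right] at h1
    · have h2 := congrArg ENNReal.toReal h1
      rw [ENNReal.toReal_mul, ENNReal.toReal_ofReal hT0.le, ENNReal.toReal_ofReal (by positivity)]
        at h2
      change T * m = _ at h2
      rw [hr] at h2
      field_simp at h2 ⊢
      linarith
    · rw [hr, div_div, ← mul_div_assoc, div_le_iff₀ (by positivity)]
      nlinarith [Real.pi_gt_three, mul_le_mul_of_nonneg_left hN' hpi.le]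
  have hm0 : 0 < m := by rw [hmval]; positivity
  set f : AddCircle T → ℝ := fun x => μ.real (Metric.closedBall x r) with hf
  have hfm : Measurable f := by
    have hmeas : MeasurableSet {p : AddCircle T × AddCircle T | dist p.2 p.1 ≤ r} :=
      (isClosed_le (continuous_snd.dist continuous_fst) continuous_const).measurableSet
    exact (measurable_measure_prodMk_left (ν := μ) hmeas).ennreal_toReal
  have hf1 : ∀ x, f x ≤ 1 := fun x => measureReal_le_one
  have hf0 : ∀ x, 0 ≤ f x := fun x => measureReal_nonneg
  have hfint : Integrable f haarAddCircle := Integrable.of_bound hfm.aestronglyMeasurable 1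
    (by filter_upwards with x; rw [Real.norm_of_nonneg (hf0 x)]; exact hf1 x)
  have hmem : MemLp (fun x => (f x : ℂ)) 2 (haarAddCircle (T := T)) :=
    MemLp.of_bound (Complex.measurable_ofReal.comp hfm).aestronglyMeasurable 1
      (by filter_upwards with x; simpa [abs_of_nonneg (hf0 x)] using hf1 x)
  have hcoeff : ∀ n, fourierCoeff (hmem.toLp : AddCircle T → ℂ) n =
      fourierCoeff (fun x => (f x : ℂ)) n := fun n =>
    integral_congr_ae (by filter_upwards [hmem.coeFn_toLp] with x hx; rw [hx])
  have hintegral : ∫ x, f x ∂haarAddCircle = m := by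
    have := fourierCoeff_measure_closedBall μ r 0
    simp only [fourierCoeff, neg_zero, fourier_zero, one_smul, integral_const, probReal_univ,
      one_mul, measureReal_restrict_apply_univ, Complex.real_smul, mul_one] at this
    rw [integral_complex_ofReal] at this
    exact_mod_cast this
  have hL2 : ∫ x, ‖(hmem.toLp : AddCircle T → ℂ) x‖ ^ 2 ∂haarAddCircle ≤ C * r ^ b * m := by
    rw [← hintegral, ← integral_const_mul]
    refine integral_mono_of_nonneg (by filter_upwards with x; positivity) (hfint.const_mul _) ?_
    filter_upwards [hmem.coeFn_toLp] with x hx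
    rw [hx, Complex.norm_real, Real.norm_of_nonneg (hf0 x), sq]
    exact mul_le_mul_of_nonneg_right (hμ x r hr0) (hf0 x)
  have hbessel := (sum_le_hasSum (Finset.Icc (-N : ℤ) N) (fun n _ => by positivity)
    (hasSum_sq_fourierCoeff hmem.toLp)).trans hL2
  have hlower : ∀ n ∈ Finset.Icc (-N : ℤ) N, ‖∫ x, fourier (-n) x ∂μ‖ ^ 2 * (m / 2) ^ 2 ≤
      ‖fourierCoeff (hmem.toLp : AddCircle T → ℂ) n‖ ^ 2 := by
    intro n hn
    rw [hcoeff, fourierCoeff_measure_closedBall, norm_mul, mul_pow]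
    have hle : m / 2 ≤ _ := half_le_norm_setIntegral_fourier (T := T) (r := r) (n := -n) (by
      have : |((-n : ℤ) : ℝ)| ≤ N := by
        rw [Finset.mem_Icc] at hn
        push_cast
        rw [abs_neg, abs_le]
        exact ⟨by exact_mod_cast hn.1, by exact_mod_cast hn.2⟩
      calc 2 * Real.pi * |((-n : ℤ) : ℝ)| * r ≤ 2 * Real.pi * N * r := by gcongr
        _ = T := by rw [hr]; field_simp)
    gcongr
  have hsum := (Finset.sum_le_sum hlower).trans hbessel
  rw [← Finset.sum_mul, ← le_div_iff₀ (by positivity)] at hsum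
  refine hsum.trans (le_of_eq ?_)
  rw [hmval, hr, Real.div_rpow (by positivity) (by positivity), Real.rpow_sub (by positivity),
    Real.rpow_one]
  have : (0 : ℝ) < (N : ℝ) ^ b := by positivity
  field_simp
  ring

end

/-- Frostman's theorem, second half: if a compact set `K` in the circle has Hausdorff
dimension `> a` (with `0 < a < 1`), then `K` supports a probability measure `μ` with
`∑_{n ≠ 0} |μ̂(n)|² / |n|^{1-a} < ∞`. -/
theorem frostman_second_half (a : ℝ) (ha : 0 < a) (ha1 : a < 1)
    (K : Set (AddCircle (2 * Real.pi))) (hK : IsCompact K)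
    (hdim : ENNReal.ofReal a < dimH K) :
    ∃ μ : Measure (AddCircle (2 * Real.pi)), IsProbabilityMeasure μ ∧ μ Kᶜ = 0 ∧
      Summable fun n : ℤ =>
        if n = 0 then (0 : ℝ) else ‖measureFourierCoeff μ n‖ ^ 2 / (|n| : ℝ) ^ (1 - a) := by
  have : Fact (0 < 2 * Real.pi) := ⟨Real.two_pi_pos⟩
  obtain ⟨b, hab, hb⟩ := ENNReal.lt_iff_exists_nnreal_btwn.1 hdim
  have hab' : a < b := by
    rw [ENNReal.ofReal_lt_iff_lt_toReal ha.le ENNReal.coe_ne_top] at hab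
    exact hab
  obtain ⟨μ, hμ, hμK, C, hC⟩ := exists_frostman_measure (ha.trans hab') hK.isClosed
    (by simp [hausdorffMeasure_of_lt_dimH hb])
  exact ⟨μ, hμ, hμK, summable_div_rpow_of_sum_le (fun n => by positivity) ha1 hab'
    (sum_sq_norm_fourier_le μ hC)⟩
end

section
/- If an analytic trigonometric series ∑_{n≥0} c(n) e^{int} converges to zero at every point of a subset E of the circle of positive Lebesgue measure, then all coefficients c(n) are zero. -/
open MeasureTheory Complex Filter

/-- Summation by parts for power series with bounded partial sums, inside the disc. -/
lemma norm_tsum_mul_pow_le_of_partialSums {a : ℕ → ℂ} {q : ℂ} {M ε : ℝ} {N : ℕ}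
    (hq : ‖q‖ < 1) (hq2 : ‖1 - q‖ ≤ 2 * (1 - ‖q‖))
    (hM : ∀ n, ‖∑ k ∈ Finset.range (n + 1), a k‖ ≤ M)
    (hε : ∀ n, N ≤ n → ‖∑ k ∈ Finset.range (n + 1), a k‖ ≤ ε) :
    ‖∑' n, a n * q ^ n‖ ≤ 2 * (1 - ‖q‖) * (N * M) + 2 * ε := by
  set T : ℕ → ℂ := fun n => ∑ k ∈ Finset.range n, a k with hT
  have hM0 : 0 ≤ M := (norm_nonneg _).trans (hM 0)
  have hε0 : 0 ≤ ε := (norm_nonneg _).trans (hε N le_rfl)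
  have hgeo := hasSum_geometric_of_lt_one (norm_nonneg q) hq
  have hsum : Summable fun n => T (n + 1) * q ^ n :=
    Summable.of_norm_bounded (hgeo.summable.mul_left M) fun n => by
      rw [norm_mul, norm_pow]
      exact mul_le_mul_of_nonneg_right (hM n) (by positivity)
  have hsum' : HasSum (fun n => T n * q ^ n) (q * ∑' n, T (n + 1) * q ^ n) := by
    have h0 : T 0 = 0 := Finset.sum_range_zero _
    have h1 : (fun n => T (n + 1) * q ^ (n + 1)) = fun n => q * (T (n + 1) * q ^ n) := by
      funext n; ring
    rw [← hasSum_nat_add_iff' 1, h1, Finset.sum_range_one, h0, zero_mul, sub_zero]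
    exact hsum.hasSum.mul_left q
  have heq : ∑' n, a n * q ^ n = (1 - q) * ∑' n, T (n + 1) * q ^ n := by
    rw [sub_mul, one_mul, ← (hsum.hasSum.sub hsum').tsum_eq]
    refine tsum_congr fun n => ?_
    simp only [hT, Finset.sum_range_succ]
    ring
  have hfin : HasSum (fun n => if n < N then M else 0) (N * M) := by
    convert hasSum_sum_of_ne_finset_zero (s := Finset.range N)
      (f := fun n => if n < N then M else 0) (L := .unconditional ℕ) ?_ using 1
    · rw [Finset.sum_congr rfl (g := fun _ => M) fun n hn => if_pos (Finset.mem_range.1 hn)]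
      simp
    · intro n hn
      exact if_neg (by simpa using hn)
  have hbd : ‖∑' n, T (n + 1) * q ^ n‖ ≤ N * M + ε * (1 - ‖q‖)⁻¹ := by
    refine tsum_of_norm_bounded (hfin.add (hgeo.mul_left ε)) fun n => ?_
    rw [norm_mul, norm_pow]
    have hp : ‖q‖ ^ n ≤ 1 := pow_le_one₀ (norm_nonneg _) hq.le
    have hp0 : 0 ≤ ‖q‖ ^ n := by positivity
    split_ifs with h
    · have := mul_le_mul (hM n) hp hp0 hM0
      nlinarith
    · have := mul_le_mul_of_nonneg_right (hε n (not_lt.1 h)) hp0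
      simpa using this
  rw [heq, norm_mul]
  have h1 : 0 < 1 - ‖q‖ := by linarith
  calc _ ≤ (2 * (1 - ‖q‖)) * (N * M + ε * (1 - ‖q‖)⁻¹) := by gcongr
    _ = _ := by field_simp

/-- In the cone `|Re w - t| ≤ Im w`, the points `exp (i (w - t))` stay in a Stolz angle. -/
lemma norm_one_sub_exp_le {w : ℂ} {t : ℝ} (h : |w.re - t| ≤ w.im) :
    ‖1 - exp (I * (w - t))‖ ≤ 2 * (1 - ‖exp (I * (w - t))‖) := by
  have hn : ‖exp (I * (w - t))‖ = Real.exp (-w.im) := by simp [norm_exp]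
  have hs : exp (I * (w - t)) = Real.exp (-w.im) * exp (I * ((w.re - t : ℝ) : ℂ)) := by
    rw [ofReal_exp, ← exp_add]
    congr 1
    conv_lhs => rw [← re_add_im w]
    push_cast
    linear_combination (w.im : ℂ) * I_sq
  have h0 : 0 ≤ w.im := (abs_nonneg _).trans h
  have h1 : w.im * Real.exp (-w.im) ≤ 1 - Real.exp (-w.im) := by
    have h2 := Real.add_one_le_exp w.im
    have h3 : Real.exp w.im * Real.exp (-w.im) = 1 := by rw [← Real.exp_add]; simp
    nlinarith [Real.exp_pos (-w.im)]
  rw [hn, hs]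
  set r := Real.exp (-w.im)
  have hr : 0 < r := Real.exp_pos _
  have hr1 : r ≤ 1 := Real.exp_le_one_iff.2 (by linarith)
  have h4 : (1 : ℂ) - r * exp (I * ((w.re - t : ℝ) : ℂ)) =
      ((1 - r : ℝ) : ℂ) - r * (exp (I * ((w.re - t : ℝ) : ℂ)) - 1) := by push_cast; ring
  rw [h4]
  refine (norm_sub_le _ _).trans ?_
  rw [norm_mul, norm_real, norm_real, Real.norm_of_nonneg (by linarith), Real.norm_of_nonneg hr.le]
  have h5 := (Real.norm_exp_I_mul_ofReal_sub_one_le (x := w.re - t)).trans h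
  nlinarith

/-- The (unnormalised) Poisson kernel of the upper half-plane has integral `π`. -/
lemma integral_poissonKernel_halfPlane (x : ℝ) {y : ℝ} (hy : 0 < y) :
    ∫ t : ℝ, y / ((t - x) ^ 2 + y ^ 2) = Real.pi := by
  have h : ∫ t : ℝ, Real.pi⁻¹ * y * ((t - x) ^ 2 + y ^ 2)⁻¹ = 1 :=
    ProbabilityTheory.integral_cauchyPDFReal_eq_one x (γ := ⟨y, hy.le⟩)
      (fun h => hy.ne' (congrArg NNReal.toReal h))
  simp only [mul_assoc, integral_const_mul] at h
  simp only [div_eq_mul_inv, integral_const_mul]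
  rwa [inv_mul_eq_one₀ Real.pi_ne_zero, eq_comm] at h

lemma integrable_poissonKernel_halfPlane (x : ℝ) {y : ℝ} (hy : 0 < y) :
    Integrable fun t : ℝ => y / ((t - x) ^ 2 + y ^ 2) :=
  Integrable.of_integral_ne_zero <| by
    rw [integral_poissonKernel_halfPlane x hy]; exact Real.pi_ne_zero

lemma setIntegral_poissonKernel_closedBall (x : ℝ) {y A : ℝ} (hy : 0 < y) (hA : 0 ≤ A) :
    ∫ t in Metric.closedBall x (A * y), y / ((t - x) ^ 2 + y ^ 2) = 2 * Real.arctan A := by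
  have hAy : 0 ≤ A * y := by positivity
  rw [Real.closedBall_eq_Icc, integral_Icc_eq_integral_Ioc,
    ← intervalIntegral.integral_of_le (by linarith),
    intervalIntegral.integral_eq_sub_of_hasDerivAt (f := fun t => Real.arctan ((t - x) / y))]
  · have h1 : (x + A * y - x) / y = A := by field_simp; ring
    have h2 : (x - A * y - x) / y = -A := by field_simp; ring
    rw [h1, h2, Real.arctan_neg]; ring
  · intro t _
    have h := (((hasDerivAt_id t).sub_const x).div_const y).arctan
    refine h.congr_deriv ?_
    simp only [id]
    field_simp
    ring
  · exact (integrable_poissonKernel_halfPlane x hy).intervalIntegrable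

/-- If the harmonic measure of `F` seen from `x + iy` exceeds one half, then `F` meets
`[x - y, x + y]`. -/
lemma exists_mem_abs_sub_le_of_lt_setIntegral {F : Set ℝ} (x : ℝ) {y : ℝ}
    (hy : 0 < y) (h : Real.pi / 2 < ∫ t in F, y / ((t - x) ^ 2 + y ^ 2)) :
    ∃ t ∈ F, |x - t| ≤ y := by
  by_contra! hcon
  have hi := integrable_poissonKernel_halfPlane x hy
  have hsub : F ⊆ (Metric.closedBall x (1 * y))ᶜ := fun t ht hb => by
    rw [Metric.mem_closedBall, dist_comm, Real.dist_eq, one_mul] at hb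
    exact absurd hb (not_le.2 (hcon t ht))
  have h1 := setIntegral_mono_set (hi.integrableOn) (ae_of_all _ fun t => by
    show 0 ≤ y / ((t - x) ^ 2 + y ^ 2)
    positivity) hsub.eventuallyLE
  have h2 := integral_add_compl (Metric.isClosed_closedBall (x := x) (ε := 1 * y)).measurableSet hi
  rw [setIntegral_poissonKernel_closedBall x hy zero_le_one, integral_poissonKernel_halfPlane x hy,
    Real.arctan_one] at h2
  linarith

/-- Near a density point of `F`, the Poisson integral of `F` exceeds any number below `π`. -/
lemma exists_lt_setIntegral_poissonKernel {F : Set ℝ} (hF : MeasurableSet F)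
    (hpos : 0 < volume F) {s : ℝ} (hs : s < Real.pi) :
    ∃ x y : ℝ, 0 < y ∧ s < ∫ t in F, y / ((t - x) ^ 2 + y ^ 2) := by
  obtain ⟨A, hA0, hA⟩ : ∃ A : ℝ, 0 < A ∧ s < 2 * Real.arctan A := by
    have h1 : ∀ᶠ A in atTop, s / 2 < Real.arctan A :=
      (Real.tendsto_arctan_atTop.mono_right nhdsWithin_le_nhds).eventually_const_lt (by linarith)
    obtain ⟨A, h2, h3⟩ := (h1.and (eventually_gt_atTop 0)).exists
    exact ⟨A, h3, by linarith⟩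
  obtain ⟨x, hx⟩ : ∃ x, Tendsto (fun r => volume (F ∩ Metric.closedBall x r) /
      volume (Metric.closedBall x r)) (nhdsWithin 0 (Set.Ioi 0)) (nhds 1) := by
    have : NeBot (ae (volume.restrict F)) := by
      rw [ae_neBot, Ne, Measure.restrict_eq_zero]; exact hpos.ne'
    exact (Besicovitch.ae_tendsto_measure_inter_div volume F).exists
  set η := (2 * Real.arctan A - s) / (2 * A) with hη
  have hη0 : 0 < η := by apply div_pos <;> linarith
  have hx' : Tendsto (fun r => volume.real (F ∩ Metric.closedBall x r) /
      volume.real (Metric.closedBall x r)) (nhdsWithin 0 (Set.Ioi 0)) (nhds 1) := by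
    have := (ENNReal.tendsto_toReal ENNReal.one_ne_top).comp hx
    simpa [Function.comp_def, ENNReal.toReal_div, Measure.real] using this
  obtain ⟨r, hr1, hr2⟩ := ((hx'.eventually_const_lt (show 1 - η < 1 by linarith)).and
    self_mem_nhdsWithin).exists
  have hr0 : 0 < r := hr2
  refine ⟨x, r / A, by positivity, ?_⟩
  set y := r / A with hy
  have hy0 : 0 < y := by positivity
  have hr : r = A * y := by rw [hy]; field_simp
  have hi := integrable_poissonKernel_halfPlane x hy0
  have hball := setIntegral_poissonKernel_closedBall x hy0 hA0.le
  rw [← hr] at hball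
  set B := Metric.closedBall x r
  have hB : MeasurableSet B := Metric.isClosed_closedBall.measurableSet
  have hBfin : volume B ≠ ⊤ := measure_closedBall_lt_top.ne
  have hvB : volume.real B = 2 * r := by
    simp [B, Measure.real, Real.volume_closedBall, hr0.le]
  have hd := integral_inter_add_sdiff hF (hi.integrableOn (s := B))
  have hm : volume.real (B ∩ F) + volume.real (B \ F) = volume.real B :=
    measureReal_inter_add_sdiff hF hBfin
  have hle : ∫ t in B ∩ F, y / ((t - x) ^ 2 + y ^ 2) ≤ ∫ t in F, y / ((t - x) ^ 2 + y ^ 2) :=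
    setIntegral_mono_set hi.integrableOn (ae_of_all _ fun t => by
      show 0 ≤ y / ((t - x) ^ 2 + y ^ 2)
      positivity) Set.inter_subset_right.eventuallyLE
  have hbad : ∫ t in B \ F, y / ((t - x) ^ 2 + y ^ 2) ≤ y⁻¹ * volume.real (B \ F) := by
    refine (Real.le_norm_self _).trans (norm_setIntegral_le_of_norm_le_const
      ((measure_mono Set.sdiff_subset).trans_lt hBfin.lt_top) fun t _ => ?_)
    rw [Real.norm_of_nonneg (by positivity), div_le_iff₀ (by positivity)]
    field_simp
    nlinarith [sq_nonneg (t - x)]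
  rw [Set.inter_comm, hvB, lt_div_iff₀ (by positivity)] at hr1
  have hlt : y⁻¹ * volume.real (B \ F) < 2 * Real.arctan A - s := by
    have h1 : volume.real (B \ F) < η * (2 * r) := by linarith
    calc _ < y⁻¹ * (η * (2 * r)) := by gcongr
      _ = _ := by rw [hη, hr]; field_simp
  linarith

/-- A holomorphic function on the upper half-plane whose real part is the Poisson integral
of the indicator function of `F`. -/
noncomputable def cauchyTransform (F : Set ℝ) (w : ℂ) : ℂ := ∫ t in F, I * (w - t)⁻¹

lemma norm_inv_sub_ofReal_le {w : ℂ} {b : ℝ} (hb : 0 < b) (hw : b ≤ w.im) (t : ℝ) :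
    ‖(w - t)⁻¹‖ ≤ b⁻¹ := by
  rw [norm_inv]
  refine inv_anti₀ hb (hw.trans ?_)
  simpa using im_le_norm (w - t)

lemma sub_ofReal_ne_zero {w : ℂ} (hw : 0 < w.im) (t : ℝ) : w - t ≠ 0 := fun h => by
  simpa [hw.ne'] using congrArg im h

lemma continuous_cauchyKernel {w : ℂ} (hw : 0 < w.im) :
    Continuous fun t : ℝ => I * (w - t)⁻¹ :=
  continuous_const.mul ((continuous_const.sub continuous_ofReal).inv₀ (sub_ofReal_ne_zero hw))

lemma integrableOn_cauchyKernel {F : Set ℝ} (hF : volume F ≠ ⊤) {w : ℂ} (hw : 0 < w.im) :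
    IntegrableOn (fun t : ℝ => I * (w - t)⁻¹) F :=
  Measure.integrableOn_of_bounded hF (continuous_cauchyKernel hw).aestronglyMeasurable
    (M := w.im⁻¹) (ae_of_all _ fun t => by
      rw [norm_mul, norm_I, one_mul]; exact norm_inv_sub_ofReal_le hw le_rfl t)

lemma re_cauchyTransform {F : Set ℝ} (hF : volume F ≠ ⊤) {w : ℂ} (hw : 0 < w.im) :
    (cauchyTransform F w).re = ∫ t in F, w.im / ((t - w.re) ^ 2 + w.im ^ 2) := by
  have h := reCLM.integral_comp_comm (integrableOn_cauchyKernel hF hw)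
  simp only [reCLM_apply] at h
  rw [cauchyTransform, ← h]
  refine integral_congr_ae (ae_of_all _ fun t => ?_)
  simp [inv_re, inv_im, normSq_apply]
  ring

lemma differentiableAt_cauchyTransform {F : Set ℝ} (hF : volume F ≠ ⊤) {w : ℂ} (hw : 0 < w.im) :
    DifferentiableAt ℂ (cauchyTransform F) w := by
  have : IsFiniteMeasure (volume.restrict F) := ⟨by simpa using hF.lt_top⟩
  have hb : 0 < w.im / 2 := by positivity
  have hopen : IsOpen {z : ℂ | w.im / 2 < z.im} := isOpen_lt continuous_const continuous_im
  refine (hasDerivAt_integral_of_dominated_loc_of_deriv_le (μ := volume.restrict F)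
    (F := fun (z : ℂ) (t : ℝ) => I * (z - t)⁻¹)
    (F' := fun (z : ℂ) (t : ℝ) => I * (-1 / (z - t) ^ 2))
    (bound := fun _ => ((w.im / 2)⁻¹) ^ 2) (hopen.mem_nhds (half_lt_self hw)) ?_
    (integrableOn_cauchyKernel hF hw) ?_ ?_ (integrable_const _) ?_).2.differentiableAt
  · filter_upwards [hopen.mem_nhds (half_lt_self hw)] with z hz
    exact (continuous_cauchyKernel (hb.trans hz)).aestronglyMeasurable
  · exact (continuous_const.mul (continuous_const.div ((continuous_const.sub
      continuous_ofReal).pow 2) fun t =>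
        pow_ne_zero 2 (sub_ofReal_ne_zero hw t))).aestronglyMeasurable
  · refine ae_of_all _ fun t z hz => ?_
    rw [norm_mul, norm_I, one_mul, neg_div, norm_neg, one_div, norm_inv, norm_pow, ← inv_pow,
      ← norm_inv]
    gcongr
    exact norm_inv_sub_ofReal_le hb (le_of_lt hz) t
  · refine ae_of_all _ fun t z hz => ?_
    exact (((hasDerivAt_id z).sub_const (t : ℂ)).inv
      (sub_ofReal_ne_zero (hb.trans hz) t)).const_mul I

lemma re_cauchyTransform_le_pi {F : Set ℝ} (hF : volume F ≠ ⊤) {w : ℂ} (hw : 0 < w.im) :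
    (cauchyTransform F w).re ≤ Real.pi := by
  rw [re_cauchyTransform hF hw, ← integral_poissonKernel_halfPlane w.re hw]
  exact setIntegral_le_integral (integrable_poissonKernel_halfPlane w.re hw)
    (ae_of_all _ fun t => by show 0 ≤ w.im / ((t - w.re) ^ 2 + w.im ^ 2); positivity)

lemma re_cauchyTransform_le_div {F : Set ℝ} (hF : volume F ≠ ⊤) {w : ℂ} (hw : 0 < w.im) :
    (cauchyTransform F w).re ≤ volume.real F / w.im := by
  refine (re_le_norm _).trans ?_
  rw [div_eq_inv_mul]
  refine norm_setIntegral_le_of_norm_le_const hF.lt_top fun t _ => ?_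
  rw [norm_mul, norm_I, one_mul]
  exact norm_inv_sub_ofReal_le hw le_rfl t

lemma hasFPowerSeriesOnBall_tsum_of_bounded {c : ℕ → ℂ} {B : ℝ} (hc : ∀ n, ‖c n‖ ≤ B) :
    HasFPowerSeriesOnBall (fun z => ∑' n, c n * z ^ n)
      (FormalMultilinearSeries.ofScalars ℂ c) 0 1 := by
  set p := FormalMultilinearSeries.ofScalars ℂ c with hp
  have hr : 1 ≤ p.radius := by
    have := p.le_radius_of_bound B (r := 1) fun n => by
      simpa [hp, FormalMultilinearSeries.ofScalars_norm] using hc n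
    simpa using this
  have hs : p.sum = fun z => ∑' n, c n * z ^ n :=
    FormalMultilinearSeries.ofScalarsSum_eq_tsum c
  rw [← hs]
  exact (p.hasFPowerSeriesOnBall (zero_lt_one.trans_le hr)).mono one_pos hr

lemma norm_exp_I_mul_lt_one {w : ℂ} (hw : 0 < w.im) : ‖exp (I * w)‖ < 1 := by
  rw [norm_exp]; simpa using hw

lemma differentiableOn_tsum_exp {c : ℕ → ℂ} {B : ℝ} (hc : ∀ n, ‖c n‖ ≤ B) :
    DifferentiableOn ℂ (fun w => ∑' n, c n * exp (I * w) ^ n) {w | 0 < w.im} := by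
  have h := (hasFPowerSeriesOnBall_tsum_of_bounded hc).differentiableOn
  refine h.comp (f := fun w => exp (I * w)) (by fun_prop) fun w hw => ?_
  simpa [← ENNReal.ofReal_one] using norm_exp_I_mul_lt_one hw

/-- Identity theorem for power series pulled back to the upper half-plane. -/
lemma coeff_eq_zero_of_eventually_tsum_exp_eq_zero {c : ℕ → ℂ} {B : ℝ} (hc : ∀ n, ‖c n‖ ≤ B)
    {w₀ : ℂ} (hw₀ : 0 < w₀.im)
    (h : ∀ᶠ w in nhds w₀, ∑' n, c n * exp (I * w) ^ n = 0) (n : ℕ) : c n = 0 := by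
  have hU : IsOpen {w : ℂ | 0 < w.im} := isOpen_lt continuous_const continuous_im
  have hF := AnalyticOnNhd.eqOn_zero_of_preconnected_of_eventuallyEq_zero
    ((differentiableOn_tsum_exp hc).analyticOnNhd hU)
    (convex_halfSpace_im_gt 0).isPreconnected hw₀ h
  have hp := (hasFPowerSeriesOnBall_tsum_of_bounded hc).hasFPowerSeriesAt
  have hpunct : ∀ᶠ z : ℂ in nhdsWithin 0 {0}ᶜ, ∑' n, c n * z ^ n = 0 := by
    filter_upwards [self_mem_nhdsWithin,
      mem_nhdsWithin_of_mem_nhds (Metric.ball_mem_nhds (0 : ℂ) one_pos)] with z hz0 hz1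
    have hz1 : ‖z‖ < 1 := by simpa using hz1
    have hz : exp (I * (-I * log z)) = z := by
      rw [← mul_assoc, mul_neg, I_mul_I, neg_neg, one_mul, exp_log hz0]
    have him : 0 < (-I * log z).im := by
      simpa [log_re] using Real.log_neg (norm_pos_iff.2 hz0) hz1
    have := hF him
    simp only [hz] at this
    simpa using this
  have hev := hp.analyticAt.frequently_zero_iff_eventually_zero.1 hpunct.frequently
  have h0 := hp.eq_zero_of_eventually hev
  rw [FormalMultilinearSeries.ofScalars_series_eq_zero] at h0
  exact congrFun h0 n

/-- A holomorphic function on the upper half-plane that is bounded on the union of the cones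
with vertices in a bounded set `F`, and tends to zero uniformly at the boundary inside these
cones, vanishes wherever the harmonic measure of `F` is large enough. -/
lemma eq_zero_of_lt_re_cauchyTransform {f : ℂ → ℂ} {F : Set ℝ} {R M s : ℝ}
    (hFR : F ⊆ Set.Icc (-R) R) (hf : DifferentiableOn ℂ f {w | 0 < w.im})
    (hM : ∀ w : ℂ, 0 < w.im → ∀ t ∈ F, |w.re - t| ≤ w.im → ‖f w‖ ≤ M)
    (hlim : ∀ ε > 0, ∃ δ > 0, ∀ w : ℂ, 0 < w.im → w.im ≤ δ → ∀ t ∈ F,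
      |w.re - t| ≤ w.im → ‖f w‖ ≤ ε)
    (hs : Real.pi / 2 < s) {w₀ : ℂ} (hw₀ : 0 < w₀.im) (h : s < (cauchyTransform F w₀).re) :
    f w₀ = 0 := by
  have hF : volume F ≠ ⊤ :=
    ((measure_mono hFR).trans_lt (by rw [Real.volume_Icc]; exact ENNReal.ofReal_lt_top)).ne
  have hcone : ∀ w : ℂ, 0 < w.im → s ≤ (cauchyTransform F w).re →
      ∃ t ∈ F, |w.re - t| ≤ w.im := fun w hw hle =>
    exists_mem_abs_sub_le_of_lt_setIntegral w.re hw
      (by rw [← re_cauchyTransform hF hw]; exact hs.trans_le hle)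
  have hs0 : 0 < s := by linarith [Real.pi_pos]
  have hM0 : 0 ≤ M := by
    obtain ⟨t, ht, htw⟩ := hcone w₀ hw₀ h.le
    exact (norm_nonneg _).trans (hM w₀ hw₀ t ht htw)
  have key : ∀ K : ℝ, 0 ≤ K →
      ‖f w₀‖ * Real.exp (K * ((cauchyTransform F w₀).re - s)) ≤ M + 1 := by
    intro K hK
    obtain ⟨δ₁, hδ₁, hsmall⟩ := hlim (Real.exp (-(K * (Real.pi - s)))) (Real.exp_pos _)
    set δ := min δ₁ (w₀.im / 2) with hδ
    have hδ0 : 0 < δ := lt_min hδ₁ (by positivity)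
    set G : ℂ → ℂ := fun w => f w * exp (K * (cauchyTransform F w - s)) with hG
    have hnG : ∀ w, ‖G w‖ = ‖f w‖ * Real.exp (K * ((cauchyTransform F w).re - s)) := by
      intro w; simp [hG, norm_exp]
    set Ω : Set ℂ := {w | δ < w.im} ∩ {w | s < (cauchyTransform F w).re} with hΩ
    have hgd : ∀ w : ℂ, 0 < w.im → ContinuousAt (fun w => (cauchyTransform F w).re) w :=
      fun w hw => continuous_re.continuousAt.comp
        (differentiableAt_cauchyTransform hF hw).continuousAt
    have hopen : IsOpen Ω :=
      ContinuousOn.isOpen_inter_preimage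
        (fun w hw => (hgd w (hδ0.trans hw)).continuousWithinAt)
        (isOpen_lt continuous_const continuous_im) isOpen_Ioi
    have hclosed : IsClosed ({w : ℂ | δ ≤ w.im} ∩ {w | s ≤ (cauchyTransform F w).re}) :=
      ContinuousOn.preimage_isClosed_of_isClosed
        (fun w hw => (hgd w (hδ0.trans_le hw)).continuousWithinAt)
        (isClosed_le continuous_const continuous_im) isClosed_Ici
    have hcl : closure Ω ⊆ {w : ℂ | δ ≤ w.im} ∩ {w | s ≤ (cauchyTransform F w).re} :=
      closure_minimal (Set.inter_subset_inter (Set.ofPred_subset_ofPred.2 fun _ => le_of_lt)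
        (Set.ofPred_subset_ofPred.2 fun _ => le_of_lt)) hclosed
    have hbdd : Bornology.IsBounded Ω := by
      set Y := volume.real F / s
      refine (((Metric.isBounded_Icc (-(R + Y)) (R + Y)).reProdIm
        (Metric.isBounded_Icc 0 Y))).subset fun w hw => ?_
      have hw0 : 0 < w.im := hδ0.trans hw.1
      obtain ⟨t, ht, htw⟩ := hcone w hw0 (le_of_lt hw.2)
      have hy : w.im ≤ Y := by
        rw [le_div_iff₀ hs0]
        have := (le_of_lt hw.2).trans (re_cauchyTransform_le_div hF hw0)
        rw [le_div_iff₀ hw0] at this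
        linarith
      have htR := hFR ht
      rw [abs_le] at htw
      exact ⟨⟨by linarith [htR.1], by linarith [htR.2]⟩, ⟨hw0.le, hy⟩⟩
    have hdiff : DiffContOnCl ℂ G Ω := by
      refine DifferentiableOn.diffContOnCl fun w hw => ?_
      have hw0 : 0 < w.im := hδ0.trans_le (hcl hw).1
      have h1 : DifferentiableAt ℂ f w :=
        hf.differentiableAt ((isOpen_lt continuous_const continuous_im).mem_nhds hw0)
      exact (h1.mul ((((differentiableAt_cauchyTransform hF hw0).sub_const _).const_mul
        _).cexp)).differentiableWithinAt
    have hfr : ∀ w ∈ frontier Ω, ‖G w‖ ≤ M + 1 := by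
      intro w hw
      obtain ⟨hw1, hw2⟩ := hcl (frontier_subset_closure hw)
      have hw1 : δ ≤ w.im := hw1
      have hw2 : s ≤ (cauchyTransform F w).re := hw2
      have hw0 : 0 < w.im := hδ0.trans_le hw1
      obtain ⟨t, ht, htw⟩ := hcone w hw0 hw2
      rw [hnG]
      by_cases him : w.im ≤ δ
      · have h1 := hsmall w hw0 (him.trans (min_le_left _ _)) t ht htw
        have h2 : Real.exp (K * ((cauchyTransform F w).re - s)) ≤
            Real.exp (K * (Real.pi - s)) := by
          have := re_cauchyTransform_le_pi hF hw0
          gcongr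
        calc _ ≤ Real.exp (-(K * (Real.pi - s))) * Real.exp (K * (Real.pi - s)) := by gcongr
          _ = 1 := by rw [← Real.exp_add]; simp
          _ ≤ M + 1 := by linarith
      · have hle : (cauchyTransform F w).re ≤ s := by
          by_contra! hlt
          rw [hopen.frontier_eq] at hw
          exact hw.2 ⟨not_le.1 him, hlt⟩
        rw [le_antisymm hle hw2, sub_self, mul_zero, Real.exp_zero, mul_one]
        linarith [hM w hw0 t ht htw]
    rw [← hnG]
    refine norm_le_of_forall_mem_frontier_norm_le hbdd hdiff hfr (subset_closure ⟨?_, h⟩)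
    exact (min_le_right _ _).trans_lt (half_lt_self hw₀)
  by_contra hne
  have hpos : 0 < ‖f w₀‖ := norm_pos_iff.2 hne
  have hd : 0 < (cauchyTransform F w₀).re - s := by linarith
  have htend : Tendsto (fun K : ℝ =>
      ‖f w₀‖ * Real.exp (K * ((cauchyTransform F w₀).re - s))) atTop atTop :=
    (Real.tendsto_exp_atTop.comp (tendsto_id.atTop_mul_const hd)).const_mul_atTop hpos
  obtain ⟨K, hK1, hK2⟩ := ((htend.eventually_gt_atTop (M + 1)).and (eventually_ge_atTop 0)).exists
  exact absurd (key K hK2) (not_le.2 hK1)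

/-- Abel's theorem on the union of the cones with vertices in a set of uniform convergence. -/
lemma norm_tsum_exp_le_of_partialSums {c : ℕ → ℂ} {M ε : ℝ} {N : ℕ} {t : ℝ}
    (hM : ∀ n, ‖∑ k ∈ Finset.range (n + 1), c k * exp (I * k * t)‖ ≤ M)
    (hε : ∀ n, N ≤ n → ‖∑ k ∈ Finset.range (n + 1), c k * exp (I * k * t)‖ ≤ ε)
    {w : ℂ} (hw : 0 < w.im) (hwt : |w.re - t| ≤ w.im) :
    ‖∑' n, c n * exp (I * w) ^ n‖ ≤ 2 * w.im * (N * M) + 2 * ε := by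
  have hM0 : 0 ≤ M := (norm_nonneg _).trans (hM 0)
  have him : (w - t).im = w.im := by simp
  have hq := norm_exp_I_mul_lt_one (w := w - t) (him ▸ hw)
  have h := norm_tsum_mul_pow_le_of_partialSums hq (norm_one_sub_exp_le hwt) hM hε
  have hterm : ∀ n : ℕ, c n * exp (I * n * t) * exp (I * (w - t)) ^ n =
      c n * exp (I * w) ^ n := by
    intro n
    rw [← exp_nat_mul, ← exp_nat_mul, mul_assoc, ← exp_add]
    ring_nf
  simp only [hterm] at h
  have h1 : 1 - ‖exp (I * (w - t))‖ ≤ w.im := by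
    have : ‖exp (I * (w - t))‖ = Real.exp (-w.im) := by simp [norm_exp]
    linarith [Real.add_one_le_exp (-w.im)]
  refine h.trans ?_
  gcongr

/-- Egorov's theorem, applied to the set of convergence to zero of a sequence of functions. -/
lemma exists_bounded_tendstoUniformlyOn_zero {S : ℕ → ℝ → ℂ} (hS : ∀ n, Continuous (S n))
    {E : Set ℝ} (hE : 0 < volume E) (hconv : ∀ t ∈ E, Tendsto (fun n => S n t) atTop (nhds 0)) :
    ∃ (F : Set ℝ) (R : ℝ), MeasurableSet F ∧ 0 < volume F ∧ F ⊆ Set.Icc (-R) R ∧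
      TendstoUniformlyOn S (fun _ => 0) atTop F := by
  set E' : Set ℝ := {t | Tendsto (fun n => S n t) atTop (nhds 0)}
  have hE' : MeasurableSet E' :=
    measurableSet_tendsto (nhds 0) fun n => (hS n).measurable
  obtain ⟨K, hKE, hK, hK0⟩ := hE'.exists_lt_isCompact (hE.trans_le (measure_mono hconv))
  have hKtop : volume K ≠ ⊤ := hK.measure_lt_top.ne
  obtain ⟨R, hR⟩ := hK.isBounded.subset_closedBall 0
  have hKreal : 0 < volume.real K := ENNReal.toReal_pos hK0.ne' hKtop
  obtain ⟨t, htK, htm, ht, hunif⟩ := tendstoUniformlyOn_of_ae_tendsto (μ := volume)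
    (fun n => (hS n).stronglyMeasurable) (stronglyMeasurable_const (b := (0 : ℂ)))
    hK.measurableSet hKtop (ae_of_all _ fun x hx => hKE hx) (half_pos hKreal)
  refine ⟨K \ t, R, hK.measurableSet.diff htm, ?_, ?_, hunif⟩
  · refine (tsub_pos_of_lt ?_).trans_le le_measure_sdiff
    refine ht.trans_lt ?_
    rw [ENNReal.ofReal_lt_iff_lt_toReal (by positivity) hKtop]
    exact half_lt_self hKreal
  · refine Set.sdiff_subset.trans (hR.trans ?_)
    rw [Real.closedBall_eq_Icc, zero_sub, zero_add]

/-- Abel–Privalov uniqueness theorem: if an analytic trigonometric series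
`∑_{n ≥ 0} c(n) e^{int}` converges to zero at every point of a set `E ⊆ ℝ` of positive
Lebesgue measure, then all coefficients vanish. -/
theorem analytic_series_vanishing_on_positive_measure (c : ℕ → ℂ) (E : Set ℝ)
    (hE : 0 < volume E)
    (hconv : ∀ t ∈ E,
      Tendsto (fun N : ℕ => ∑ n ∈ Finset.range (N + 1), c n * Complex.exp (Complex.I * n * t))
        atTop (nhds 0)) :
    ∀ n, c n = 0 := by
  obtain ⟨F, R, hF, hF0, hFR, hunif⟩ := exists_bounded_tendstoUniformlyOn_zero
    (S := fun N (t : ℝ) => ∑ n ∈ Finset.range (N + 1), c n * exp (I * n * t))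
    (fun N => by fun_prop) hE hconv
  have hnorm : ∀ (n : ℕ) (t : ℝ), ‖c n * exp (I * n * t)‖ = ‖c n‖ := by
    intro n t; simp [norm_exp]
  have hsmall : ∀ ε > 0, ∃ N, ∀ n, N ≤ n → ∀ t ∈ F,
      ‖∑ k ∈ Finset.range (n + 1), c k * exp (I * k * t)‖ ≤ ε := by
    intro ε hε
    obtain ⟨N, hN⟩ := eventually_atTop.1 (Metric.tendstoUniformlyOn_iff.1 hunif ε hε)
    exact ⟨N, fun n hn t ht => by simpa using (hN n hn t ht).le⟩
  obtain ⟨M, hM⟩ : ∃ M, ∀ t ∈ F, ∀ n,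
      ‖∑ k ∈ Finset.range (n + 1), c k * exp (I * k * t)‖ ≤ M := by
    obtain ⟨N, hN⟩ := hsmall 1 one_pos
    have hsum : 0 ≤ ∑ k ∈ Finset.range N, ‖c k‖ := Finset.sum_nonneg fun _ _ => norm_nonneg _
    refine ⟨∑ k ∈ Finset.range N, ‖c k‖ + 1, fun t ht n => ?_⟩
    rcases le_or_gt N n with hn | hn
    · linarith [hN n hn t ht]
    · refine (norm_sum_le _ _).trans ?_
      simp only [hnorm]
      have := Finset.sum_le_sum_of_subset_of_nonneg (f := fun k => ‖c k‖)
        (Finset.range_mono hn) fun _ _ _ => norm_nonneg _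
      linarith
  obtain ⟨t₀, ht₀⟩ := nonempty_of_measure_ne_zero hF0.ne'
  have hM0 : 0 ≤ M := (norm_nonneg _).trans (hM t₀ ht₀ 0)
  have hc : ∀ n, ‖c n‖ ≤ 2 * M := by
    intro n
    rw [← hnorm n t₀]
    rcases n with _ | n
    · have := hM t₀ ht₀ 0
      rw [zero_add, Finset.sum_range_one] at this
      linarith
    · rw [← Finset.sum_range_succ_sub_sum (fun k : ℕ => c k * exp (I * k * t₀))]
      linarith [norm_sub_le (∑ k ∈ Finset.range (n + 1 + 1), c k * exp (I * k * t₀))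
        (∑ k ∈ Finset.range (n + 1), c k * exp (I * k * t₀)), hM t₀ ht₀ (n + 1), hM t₀ ht₀ n]
  have hFtop : volume F ≠ ⊤ :=
    ((measure_mono hFR).trans_lt (by rw [Real.volume_Icc]; exact ENNReal.ofReal_lt_top)).ne
  obtain ⟨s, hs1, hs2⟩ := exists_between (show Real.pi / 2 < Real.pi by linarith [Real.pi_pos])
  obtain ⟨x, y, hy, hxy⟩ := exists_lt_setIntegral_poissonKernel hF hF0 hs2
  set w₀ : ℂ := ⟨x, y⟩
  have hw₀ : 0 < w₀.im := hy
  have hgw₀ : s < (cauchyTransform F w₀).re := by rwa [re_cauchyTransform hFtop hw₀]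
  have hzero : ∀ w : ℂ, 0 < w.im → s < (cauchyTransform F w).re →
      ∑' n, c n * exp (I * w) ^ n = 0 := by
    intro w hw hgw
    refine eq_zero_of_lt_re_cauchyTransform (f := fun w => ∑' n, c n * exp (I * w) ^ n)
      (M := 2 * M) hFR (differentiableOn_tsum_exp hc) ?_ ?_ hs1 hw hgw
    · intro w hw t ht hwt
      simpa using norm_tsum_exp_le_of_partialSums (hM t ht) (N := 0)
        (fun n _ => hM t ht n) hw hwt
    · intro ε hε
      obtain ⟨N, hN⟩ := hsmall (ε / 4) (by positivity)
      refine ⟨ε / (4 * (N * M + 1)), by positivity, fun w hw hwδ t ht hwt => ?_⟩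
      refine (norm_tsum_exp_le_of_partialSums (hM t ht) (fun n hn => hN n hn t ht) hw hwt).trans ?_
      rw [le_div_iff₀ (by positivity)] at hwδ
      linarith
  refine coeff_eq_zero_of_eventually_tsum_exp_eq_zero hc hw₀ ?_
  have hcont : ContinuousAt (fun w => (cauchyTransform F w).re) w₀ :=
    continuous_re.continuousAt.comp (differentiableAt_cauchyTransform hFtop hw₀).continuousAt
  filter_upwards [hcont.eventually_const_lt hgw₀,
    (isOpen_lt continuous_const continuous_im).mem_nhds hw₀] with w hw1 hw2
  exact hzero w hw2 hw1
end

section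
/- A function F analytic on the open unit disc that has non-tangential limit zero at every point of a subset of the unit circle of positive Lebesgue measure is identically zero. -/
open MeasureTheory Complex Filter Metric

/-- The Stolz angle (nontangential approach region) at a boundary point `ζ` of the unit
disc, with aperture parameter `M`. -/
def stolzAngle (ζ : ℂ) (M : ℝ) : Set ℂ :=
  {z : ℂ | ‖z‖ < 1 ∧ ‖ζ - z‖ < M * (1 - ‖z‖)}

/-- `F` has non-tangential limit `L` at the boundary point `ζ` if `F(z) → L` as
`z → ζ` within every Stolz angle at `ζ`. -/
def HasNontangentialLimit (F : ℂ → ℂ) (ζ L : ℂ) : Prop :=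
  ∀ M : ℝ, 1 < M → Tendsto F (nhdsWithin ζ (stolzAngle ζ M)) (nhds L)

/-- The points `ζ` such that `‖F‖ ≤ ε` on the part of the Stolz angle at `ζ` within `δ` of the
unit circle. -/
def smallOnStolz (F : ℂ → ℂ) (M ε δ : ℝ) : Set ℂ :=
  {ζ | ∀ z ∈ stolzAngle ζ M, 1 - δ < ‖z‖ → ‖F z‖ ≤ ε}

theorem isClosed_smallOnStolz (F : ℂ → ℂ) (M ε δ : ℝ) : IsClosed (smallOnStolz F M ε δ) := by
  have : smallOnStolz F M ε δ = ⋂ z : ℂ, ⋂ _ : ‖z‖ < 1 ∧ 1 - δ < ‖z‖ ∧ ε < ‖F z‖,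
      {ζ : ℂ | M * (1 - ‖z‖) ≤ ‖ζ - z‖} := by
    ext ζ
    simp only [smallOnStolz, stolzAngle, Set.mem_iInter, Set.mem_ofPred_eq]
    refine forall_congr' fun z => ?_
    rw [← not_lt, ← not_lt]
    tauto
  rw [this]
  exact isClosed_iInter fun z => isClosed_iInter fun _ => isClosed_le (by fun_prop) (by fun_prop)

theorem smallOnStolz_anti {F : ℂ → ℂ} {M ε δ δ' : ℝ} (h : δ ≤ δ') :
    smallOnStolz F M ε δ' ⊆ smallOnStolz F M ε δ :=
  fun _ hζ z hz hδ => hζ z hz (by linarith)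

theorem HasNontangentialLimit.exists_mem_smallOnStolz {F : ℂ → ℂ} {ζ : ℂ}
    (h : HasNontangentialLimit F ζ 0) {M : ℝ} (hM : 1 < M) {ε : ℝ} (hε : 0 < ε) :
    ∃ k : ℕ, ζ ∈ smallOnStolz F M ε (1 / ((k : ℝ) + 1)) := by
  have h1 := (Metric.tendsto_nhdsWithin_nhds.1 (h M hM)) ε hε
  obtain ⟨d, hd, h2⟩ := h1
  obtain ⟨k, hk⟩ := exists_nat_one_div_lt (div_pos hd (by linarith : 0 < M))
  refine ⟨k, fun z hz hzk => ?_⟩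
  have h3 : dist z ζ < d := by
    rw [dist_comm, dist_eq_norm]
    refine hz.2.trans ?_
    rw [lt_div_iff₀ (by linarith)] at hk
    nlinarith
  simpa using (h2 hz h3).le

/-- An Egorov theorem for increasing families of sets, indexed by a precision `j` and a rate `k`,
which exhaust a possibly nonmeasurable set `E`. -/
theorem exists_measure_iInter_pos {α : Type*} [MeasurableSpace α] {μ : Measure α} [SigmaFinite μ]
    {E : Set α} (hE : 0 < μ E) {P : ℕ → ℕ → Set α} (hP : ∀ j k, MeasurableSet (P j k))
    (hmono : ∀ j, Monotone (P j)) (hEP : ∀ j, ∀ x ∈ E, ∃ k, x ∈ P j k) :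
    ∃ k : ℕ → ℕ, 0 < μ (⋂ j, P j (k j)) := by
  obtain ⟨n, hn⟩ : ∃ n, 0 < μ (E ∩ spanningSets μ n) := by
    by_contra! h
    have : μ (⋃ n, E ∩ spanningSets μ n) = 0 := measure_iUnion_null fun n => by simpa using h n
    rw [← Set.inter_iUnion, iUnion_spanningSets, Set.inter_univ] at this
    exact hE.ne' this
  set E' := E ∩ spanningSets μ n
  set ν := μ.restrict E'
  have hfin : IsFiniteMeasure ν := ⟨by
    rw [Measure.restrict_apply_univ]
    exact (measure_mono Set.inter_subset_right).trans_lt (measure_spanningSets_lt_top μ n)⟩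
  have hν : 0 < ν Set.univ := by rwa [Measure.restrict_apply_univ]
  obtain ⟨w, hw, hws⟩ := ENNReal.exists_pos_sum_of_countable hν.ne' ℕ
  have hk : ∀ j, ∃ k, ν (P j k)ᶜ < w j := by
    intro j
    have ht : Tendsto (fun k => ν (P j k)ᶜ) atTop (nhds (ν (⋂ k, (P j k)ᶜ))) :=
      tendsto_measure_iInter_atTop (fun k => (hP j k).compl.nullMeasurableSet)
        (fun a b hab => Set.compl_subset_compl.2 (hmono j hab)) ⟨0, measure_ne_top _ _⟩
    have h0 : ν (⋂ k, (P j k)ᶜ) = 0 := by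
      rw [Measure.restrict_apply (MeasurableSet.iInter fun k => (hP j k).compl)]
      convert measure_empty (μ := μ)
      ext x
      simp only [Set.mem_inter_iff, Set.mem_iInter, Set.mem_compl_iff, Set.mem_empty_iff_false,
        iff_false, not_and]
      intro hx hxE
      obtain ⟨k, hk⟩ := hEP j x hxE.1
      exact hx k hk
    rw [h0] at ht
    exact (ht.eventually_lt_const (by exact_mod_cast hw j)).exists
  choose k hk using hk
  refine ⟨k, ?_⟩
  by_contra! h0
  have h1 : ν (⋂ j, P j (k j)) = 0 :=
    le_antisymm ((Measure.restrict_apply_le _ _).trans h0) bot_le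
  have h2 : ν (⋂ j, P j (k j))ᶜ < ν Set.univ := by
    rw [Set.compl_iInter]
    exact ((measure_iUnion_le _).trans (ENNReal.tsum_le_tsum fun j => (hk j).le)).trans_lt hws
  have h3 := measure_add_measure_compl (μ := ν) (MeasurableSet.iInter fun j => hP j (k j))
  rw [h1, zero_add] at h3
  exact h2.ne h3

/-- Egorov's theorem for nontangential limits. -/
theorem exists_uniform_nontangentialLimit {F : ℂ → ℂ} {E : Set ℝ} (hE : 0 < volume E)
    (hlim : ∀ t ∈ E, HasNontangentialLimit F (exp (I * t)) 0) {M : ℝ} (hM : 1 < M) :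
    ∃ B : Set ℂ, MeasurableSet B ∧ 0 < volume {t : ℝ | exp (I * t) ∈ B} ∧
      ∀ ε > 0, ∃ δ > 0, B ⊆ smallOnStolz F M ε δ := by
  let C : ℕ → ℕ → Set ℂ := fun j k => smallOnStolz F M (1 / ((j : ℝ) + 1)) (1 / ((k : ℝ) + 1))
  have hC : ∀ j k, MeasurableSet (C j k) := fun j k => (isClosed_smallOnStolz _ _ _ _).measurableSet
  have hmeas : Measurable fun t : ℝ => exp (I * t) := by fun_prop
  obtain ⟨k, hk⟩ := exists_measure_iInter_pos (μ := volume) hE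
    (P := fun j k => (fun t : ℝ => exp (I * t)) ⁻¹' C j k) (fun j k => hmeas (hC j k))
    (fun j a b hab => Set.preimage_mono (smallOnStolz_anti (by gcongr)))
    (fun j t ht => (hlim t ht).exists_mem_smallOnStolz hM (by positivity))
  refine ⟨⋂ j, C j (k j), MeasurableSet.iInter fun j => hC j _, ?_, fun ε hε => ?_⟩
  · rwa [← Set.preimage_iInter] at hk
  · obtain ⟨j, hj⟩ := exists_nat_one_div_lt hε
    exact ⟨1 / ((k j : ℝ) + 1), by positivity, fun ζ hζ z hz hzk =>
      (Set.mem_iInter.1 hζ j z hz hzk).trans hj.le⟩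

/-- The maximum principle for `F * exp (K * h)` as `K → ∞`. -/
theorem eq_zero_of_barrier {F h : ℂ → ℂ} (hF : DifferentiableOn ℂ F (ball 0 1))
    (hh : DifferentiableOn ℂ h (ball 0 1)) {B : Set ℂ} {M C : ℝ}
    (hB : ∀ ε > 0, ∃ δ > 0, B ⊆ smallOnStolz F M ε δ)
    (hC : ∀ z ∈ ball (0 : ℂ) 1, (h z).re ≤ C)
    (hhB : ∀ z ∈ ball (0 : ℂ) 1, 0 < (h z).re → ∃ ζ ∈ B, z ∈ stolzAngle ζ M)
    {z : ℂ} (hz : z ∈ ball (0 : ℂ) 1) (hzpos : 0 < (h z).re) : F z = 0 := by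
  obtain ⟨N, hN, hFN⟩ : ∃ N > 0, ∀ w ∈ ball (0 : ℂ) 1, 0 < (h w).re → ‖F w‖ ≤ N := by
    obtain ⟨δ, hδ, h1⟩ := hB 1 one_pos
    have hsub : closedBall (0 : ℂ) (1 - δ) ⊆ ball 0 1 := closedBall_subset_ball (by linarith)
    obtain ⟨N, hN⟩ := (isCompact_closedBall (0 : ℂ) (1 - δ)).exists_bound_of_continuousOn
      (hF.continuousOn.mono hsub)
    refine ⟨max N 1, by positivity, fun w hw hwp => ?_⟩
    rcases le_or_gt ‖w‖ (1 - δ) with h2 | h2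
    · exact (hN w (by simpa using h2)).trans (le_max_left _ _)
    · obtain ⟨ζ, hζ, hwζ⟩ := hhB w hw hwp
      exact (h1 hζ w hwζ h2).trans (le_max_right _ _)
  have key : ∀ K : ℕ, ‖F z‖ * Real.exp (K * (h z).re) ≤ N := by
    intro K
    obtain ⟨δ, hδ, h1⟩ := hB (N * Real.exp (-(K * C))) (by positivity)
    have hz1 : ‖z‖ < 1 := by simpa using hz
    obtain ⟨R, hR1, hR2⟩ := exists_between (max_lt hz1 (by linarith : 1 - δ < 1))
    have hRz : ‖z‖ < R := (le_max_left _ _).trans_lt hR1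
    have hRδ : 1 - δ < R := (le_max_right _ _).trans_lt hR1
    let U : Set ℂ := ball 0 R ∩ {w | 0 < (h w).re}
    have hsub : closedBall (0 : ℂ) R ⊆ ball 0 1 := closedBall_subset_ball hR2
    have hcl : closure U ⊆ closedBall 0 R :=
      (closure_mono Set.inter_subset_left).trans closure_ball_subset_closedBall
    have hcR : ContinuousOn (fun w => (h w).re) (ball 0 R) :=
      continuous_re.comp_continuousOn
        (hh.continuousOn.mono (ball_subset_closedBall.trans hsub))
    have hUo : IsOpen U := hcR.isOpen_inter_preimage isOpen_ball isOpen_Ioi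
    have hG : DifferentiableOn ℂ (fun w => F w * exp (K * h w)) (ball 0 1) :=
      hF.mul ((hh.const_mul _).cexp)
    have hnorm : ∀ w, ‖F w * exp (K * h w)‖ = ‖F w‖ * Real.exp (K * (h w).re) := by
      intro w
      simp [norm_exp]
    have hmax : ∀ w ∈ frontier U, ‖F w * exp (K * h w)‖ ≤ N := by
      intro w hw
      have hwcl : w ∈ closure U := hw.1
      have hwR : ‖w‖ ≤ R := by simpa using hcl hwcl
      have hw1 : w ∈ ball (0 : ℂ) 1 := hsub (hcl hwcl)
      have hmap : ∀ {g : ℂ → ℝ} {s : Set ℝ}, IsClosed s → ContinuousAt g w →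
          (∀ v ∈ U, g v ∈ s) → g w ∈ s := fun hs hg hgU =>
        hs.closure_subset_iff.2 (Set.image_subset_iff.2 hgU) (mem_closure_image hg hwcl)
      have hhw : ContinuousAt h w := hh.continuousOn.continuousAt (isOpen_ball.mem_nhds hw1)
      have hFw : ContinuousAt F w := hF.continuousOn.continuousAt (isOpen_ball.mem_nhds hw1)
      have hw0 : 0 ≤ (h w).re := hmap (g := fun v => (h v).re) isClosed_Ici
        (continuous_re.continuousAt.comp hhw) fun v hv => le_of_lt (a := (0 : ℝ)) hv.2
      have hwN : ‖F w‖ ≤ N := hmap (g := fun v => ‖F v‖) isClosed_Iic hFw.norm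
        fun v hv => hFN v (hsub (ball_subset_closedBall hv.1)) hv.2
      rw [hnorm]
      rcases hw0.eq_or_lt with h0 | h0
      · simpa [← h0] using hwN
      have hwR' : R ≤ ‖w‖ := by
        by_contra! hlt
        exact (hUo.frontier_eq ▸ hw).2 ⟨by simpa using hlt, h0⟩
      obtain ⟨ζ, hζ, hwζ⟩ := hhB w hw1 h0
      calc ‖F w‖ * Real.exp (K * (h w).re)
          ≤ N * Real.exp (-(K * C)) * Real.exp (K * C) := by
            gcongr
            · exact h1 hζ w hwζ (by linarith)
            · exact hC w hw1
        _ = N := by rw [mul_assoc, ← Real.exp_add]; simp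
    rw [← hnorm]
    exact norm_le_of_forall_mem_frontier_norm_le (f := fun w => F w * exp (K * h w))
      (isBounded_ball.subset Set.inter_subset_left) (hG.mono (hcl.trans hsub)).diffContOnCl hmax
      (subset_closure ⟨by simpa using hRz, hzpos⟩)
  by_contra hFz
  have hpos : 0 < ‖F z‖ * (h z).re := mul_pos (norm_pos_iff.2 hFz) hzpos
  obtain ⟨K, hK⟩ := exists_nat_gt (N / (‖F z‖ * (h z).re))
  rw [div_lt_iff₀ hpos] at hK
  have h1 := Real.add_one_le_exp (K * (h z).re)
  have h2 := mul_le_mul_of_nonneg_left h1 (norm_nonneg (F z))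
  nlinarith [key K, norm_nonneg (F z)]

/-- The Poisson kernel `(1 - r²) / |e^{ix} - r|²` of the unit disc. -/
noncomputable def unitPoisson (r x : ℝ) : ℝ :=
  (1 - r ^ 2) / (1 + r ^ 2 - 2 * r * Real.cos x)

section UnitPoisson

variable {r x : ℝ}

theorem unitPoisson_denom_ge (h0 : 0 ≤ r) :
    (1 - r) ^ 2 ≤ 1 + r ^ 2 - 2 * r * Real.cos x := by
  nlinarith [Real.cos_le_one x]

theorem unitPoisson_denom_pos (h0 : 0 ≤ r) (h1 : r < 1) :
    0 < 1 + r ^ 2 - 2 * r * Real.cos x :=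
  (pow_pos (sub_pos.2 h1) 2).trans_le (unitPoisson_denom_ge h0)

theorem unitPoisson_nonneg (h0 : 0 ≤ r) (h1 : r < 1) : 0 ≤ unitPoisson r x :=
  div_nonneg (by nlinarith) (unitPoisson_denom_pos h0 h1).le

theorem continuous_unitPoisson (h0 : 0 ≤ r) (h1 : r < 1) : Continuous (unitPoisson r) :=
  Continuous.div (by fun_prop) (by fun_prop) fun _ => (unitPoisson_denom_pos h0 h1).ne'

theorem unitPoisson_le (h0 : 0 ≤ r) (h1 : r < 1) : unitPoisson r x ≤ 2 / (1 - r) := by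
  rw [unitPoisson, div_le_div_iff₀ (unitPoisson_denom_pos h0 h1) (by linarith)]
  nlinarith [unitPoisson_denom_ge (x := x) h0]

theorem le_unitPoisson (h0 : 0 ≤ r) (h1 : r < 1) (hx : |x| ≤ 1 - r) :
    1 / (4 * (1 - r)) ≤ unitPoisson r x := by
  rw [unitPoisson, div_le_div_iff₀ (by linarith) (unitPoisson_denom_pos h0 h1)]
  have h2 := Real.one_sub_sq_div_two_le_cos (x := x)
  have h3 : x ^ 2 ≤ (1 - r) ^ 2 := sq_le_sq' (abs_le.1 hx).1 (abs_le.1 hx).2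
  have h4 : 2 * r * (1 - Real.cos x) ≤ 2 * (1 - r) ^ 2 := by
    have : 1 - Real.cos x ≤ (1 - r) ^ 2 := by nlinarith
    nlinarith [sq_nonneg (1 - r), Real.cos_le_one x]
  nlinarith

theorem unitPoisson_le_of_le_abs (h0 : 1 / 2 ≤ r) (h1 : r < 1) {s : ℝ} (hs : 0 < s)
    (hsx : s ≤ |x|) (hx : |x| ≤ Real.pi) :
    unitPoisson r x ≤ 2 * Real.pi ^ 2 * (1 - r) / s ^ 2 * (1 + (x / s) ^ 2)⁻¹ := by
  have h2 := Real.cos_le_one_sub_mul_cos_sq hx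
  have h3 : s ^ 2 ≤ x ^ 2 := by rw [← sq_abs x]; gcongr
  have hx0 : 0 < x ^ 2 := (pow_pos hs 2).trans_le h3
  have hpi := Real.pi_pos
  have h4 : 2 * x ^ 2 / Real.pi ^ 2 ≤ 1 + r ^ 2 - 2 * r * Real.cos x := by
    have : 2 * x ^ 2 / Real.pi ^ 2 ≤ 1 - Real.cos x := by
      have : 2 * x ^ 2 / Real.pi ^ 2 = 2 / Real.pi ^ 2 * x ^ 2 := by ring
      linarith
    nlinarith [sq_nonneg (1 - r), Real.cos_le_one x]
  calc unitPoisson r x ≤ (2 * (1 - r)) / (2 * x ^ 2 / Real.pi ^ 2) := by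
        unfold unitPoisson
        gcongr
        nlinarith
    _ = 2 * Real.pi ^ 2 * (1 - r) / (2 * x ^ 2) := by field_simp
    _ ≤ 2 * Real.pi ^ 2 * (1 - r) / (s ^ 2 + x ^ 2) := by
        have : 0 < 1 - r := by linarith
        gcongr
        linarith
    _ = _ := by field_simp

end UnitPoisson

theorem integral_inv_one_add_div_sq_le {s : ℝ} (hs : 0 < s) (a b : ℝ) :
    ∫ x in a..b, (1 + (x / s) ^ 2)⁻¹ ≤ Real.pi * s := by
  rw [intervalIntegral.integral_comp_div (fun x => (1 + x ^ 2)⁻¹) hs.ne', integral_inv_one_add_sq,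
    smul_eq_mul, mul_comm]
  gcongr
  linarith [Real.arctan_lt_pi_div_two (b / s), Real.neg_pi_div_two_lt_arctan (a / s)]

/-- The Poisson integral of the indicator function of a set `S` of angles, at the point
`r e^{iθ}` of the unit disc. -/
noncomputable def unitPoissonIntegral (S : Set ℝ) (r θ : ℝ) : ℝ :=
  (2 * Real.pi)⁻¹ * ∫ x in -Real.pi..Real.pi, unitPoisson r x * S.indicator 1 (x + θ)

theorem measurable_indicator_add {S : Set ℝ} (hS : MeasurableSet S) (θ : ℝ) :
    Measurable fun x : ℝ => S.indicator (1 : ℝ → ℝ) (x + θ) :=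
  (measurable_one.indicator hS).comp (by fun_prop)

theorem intervalIntegrable_unitPoisson_mul {S : Set ℝ} (hS : MeasurableSet S) {r : ℝ} (h0 : 0 ≤ r)
    (h1 : r < 1) (θ a b : ℝ) :
    IntervalIntegrable (fun x => unitPoisson r x * S.indicator 1 (x + θ)) volume a b := by
  refine ((continuous_unitPoisson h0 h1).intervalIntegrable a b).mono_fun'
    ((continuous_unitPoisson h0 h1).measurable.mul
      (measurable_indicator_add hS θ)).aestronglyMeasurable (ae_of_all _ fun x => ?_)
  by_cases hx : x + θ ∈ S
  · simp [hx, abs_of_nonneg (unitPoisson_nonneg h0 h1)]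
  · simp [hx, unitPoisson_nonneg h0 h1]

theorem unitPoissonIntegral_nonneg (S : Set ℝ) {r : ℝ} (h0 : 0 ≤ r) (h1 : r < 1) (θ : ℝ) :
    0 ≤ unitPoissonIntegral S r θ := by
  refine mul_nonneg (by positivity) (intervalIntegral.integral_nonneg (by linarith [Real.pi_pos])
    fun x _ => mul_nonneg (unitPoisson_nonneg h0 h1) (Set.indicator_nonneg (by simp) _))

theorem le_unitPoissonIntegral {S : Set ℝ} (hS : MeasurableSet S) {r : ℝ} (h0 : 0 ≤ r)
    (h1 : r < 1) {θ : ℝ} (hθ : ∀ x, |x| < 1 - r → x + θ ∈ S) :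
    1 / (4 * Real.pi) ≤ unitPoissonIntegral S r θ := by
  have hpi := Real.pi_gt_three
  have hnn : ∀ x, 0 ≤ unitPoisson r x * S.indicator 1 (x + θ) := fun x =>
    mul_nonneg (unitPoisson_nonneg h0 h1) (Set.indicator_nonneg (by simp) _)
  have h2 : ∫ x in -(1 - r)..(1 - r), unitPoisson r x * S.indicator 1 (x + θ) ≤
      ∫ x in -Real.pi..Real.pi, unitPoisson r x * S.indicator 1 (x + θ) :=
    intervalIntegral.integral_mono_interval (by linarith) (by linarith) (by linarith)
      (ae_of_all _ hnn) (intervalIntegrable_unitPoisson_mul hS h0 h1 _ _ _)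
  have h3 : ∫ x in -(1 - r)..(1 - r), 1 / (4 * (1 - r)) ≤
      ∫ x in -(1 - r)..(1 - r), unitPoisson r x * S.indicator 1 (x + θ) := by
    refine intervalIntegral.integral_mono_on_of_le_Ioo (by linarith) (by simp)
      (intervalIntegrable_unitPoisson_mul hS h0 h1 _ _ _) fun x hx => ?_
    have hx' : |x| < 1 - r := abs_lt.2 hx
    simpa [hθ x hx'] using le_unitPoisson h0 h1 hx'.le
  have h4 : ∫ x in -(1 - r)..(1 - r), 1 / (4 * (1 - r)) = 1 / 2 := by
    have : 1 - r ≠ 0 := by linarith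
    rw [intervalIntegral.integral_const, smul_eq_mul]
    field_simp
    norm_num
  calc 1 / (4 * Real.pi) = (2 * Real.pi)⁻¹ * (1 / 2) := by field_simp; norm_num
    _ ≤ _ := by
      unfold unitPoissonIntegral
      gcongr
      linarith

theorem unitPoissonIntegral_le {S : Set ℝ} (hS : MeasurableSet S) {r s : ℝ} (h0 : 1 / 2 ≤ r)
    (h1 : r < 1) (hs : 0 < s) (θ : ℝ) :
    unitPoissonIntegral S r θ ≤ Real.pi ^ 2 * ((1 - r) / s) +
      (Real.pi * (1 - r))⁻¹ * volume.real (S ∩ closedBall θ s) := by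
  have hpi := Real.pi_pos
  have h0' : 0 ≤ r := by linarith
  have hr : 0 < 1 - r := by linarith
  set D : Set ℝ := S ∩ closedBall θ s
  have hD : MeasurableSet D := hS.inter measurableSet_closedBall
  have hDint : ∫ x in -Real.pi..Real.pi, D.indicator (1 : ℝ → ℝ) (x + θ) ≤ volume.real D := by
    rw [intervalIntegral.integral_comp_add_right (D.indicator (1 : ℝ → ℝ)),
      intervalIntegral.integral_of_le (by linarith), integral_indicator_one hD]
    rw [measureReal_restrict_apply hD]
    exact measureReal_mono Set.inter_subset_left
      ((measure_mono Set.inter_subset_right).trans_lt measure_closedBall_lt_top).ne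
  have hDii : IntervalIntegrable (fun x => 2 / (1 - r) * D.indicator (1 : ℝ → ℝ) (x + θ)) volume
      (-Real.pi) Real.pi := by
    refine IntervalIntegrable.const_mul ?_ _
    refine (intervalIntegrable_const (c := (1 : ℝ))).mono_fun'
      (measurable_indicator_add hD θ).aestronglyMeasurable (ae_of_all _ fun x => ?_)
    by_cases hx : x + θ ∈ D <;> simp [hx]
  have hTii : IntervalIntegrable
      (fun x => 2 * Real.pi ^ 2 * (1 - r) / s ^ 2 * (1 + (x / s) ^ 2)⁻¹) volume
      (-Real.pi) Real.pi := by
    refine Continuous.intervalIntegrable ?_ _ _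
    exact continuous_const.mul (Continuous.inv₀ (by fun_prop) fun x => by positivity)
  have hle : ∫ x in -Real.pi..Real.pi, unitPoisson r x * S.indicator 1 (x + θ) ≤
      ∫ x in -Real.pi..Real.pi, (2 / (1 - r) * D.indicator 1 (x + θ) +
        2 * Real.pi ^ 2 * (1 - r) / s ^ 2 * (1 + (x / s) ^ 2)⁻¹) := by
    refine intervalIntegral.integral_mono_on (by linarith)
      (intervalIntegrable_unitPoisson_mul hS h0' h1 _ _ _) (hDii.add hTii) fun x hx => ?_
    have hT : 0 ≤ 2 * Real.pi ^ 2 * (1 - r) / s ^ 2 * (1 + (x / s) ^ 2)⁻¹ := by positivity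
    have hDnn : 0 ≤ 2 / (1 - r) * D.indicator (1 : ℝ → ℝ) (x + θ) :=
      mul_nonneg (by positivity) (Set.indicator_nonneg (by simp) _)
    by_cases hxS : x + θ ∈ S
    · rcases le_total |x| s with hxs | hxs
      · have hxD : x + θ ∈ D := ⟨hxS, by simpa [Real.dist_eq] using hxs⟩
        simp only [hxS, hxD, Set.indicator_of_mem, Pi.one_apply, mul_one]
        linarith [unitPoisson_le (x := x) h0' h1]
      · simp only [hxS, Set.indicator_of_mem, Pi.one_apply, mul_one]
        linarith [unitPoisson_le_of_le_abs h0 h1 hs hxs (abs_le.2 hx)]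
    · simp only [hxS, not_false_eq_true, Set.indicator_of_notMem, mul_zero]
      linarith
  rw [intervalIntegral.integral_add hDii hTii, intervalIntegral.integral_const_mul,
    intervalIntegral.integral_const_mul] at hle
  calc unitPoissonIntegral S r θ
      ≤ (2 * Real.pi)⁻¹ * (2 / (1 - r) * volume.real D +
          2 * Real.pi ^ 2 * (1 - r) / s ^ 2 * (Real.pi * s)) := by
        unfold unitPoissonIntegral
        gcongr
        refine hle.trans ?_
        gcongr
        exact integral_inv_one_add_div_sq_le hs _ _
    _ = _ := by
        field_simp
        ring

/-- Near a density point of `A`, the Poisson integral of the complement of `A` is small. -/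
theorem exists_unitPoissonIntegral_lt {A : Set ℝ} (hA : MeasurableSet A) (hpos : 0 < volume A)
    {c : ℝ} (hc : 0 < c) :
    ∃ r θ : ℝ, 0 ≤ r ∧ r < 1 ∧ unitPoissonIntegral Aᶜ r θ < c := by
  obtain ⟨θ, hθA, hθ⟩ : ∃ θ ∈ A, Tendsto (fun s => volume (Aᶜ ∩ closedBall θ s) /
      volume (closedBall θ s)) (nhdsWithin 0 (Set.Ioi 0)) (nhds 0) := by
    have h := Besicovitch.ae_tendsto_measure_inter_div_of_measurableSet volume hA.compl
    obtain ⟨θ, hθA, hθ⟩ := (frequently_ae_mem_iff.2 hpos.ne').and_eventually h |>.exists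
    exact ⟨θ, hθA, by simpa [hθA] using hθ⟩
  have hpi := Real.pi_pos
  set ε : ℝ := min (1 / 2) (c / (4 * Real.pi ^ 2))
  have hε : 0 < ε := by positivity
  have hεc : Real.pi ^ 2 * ε ≤ c / 4 := by
    calc Real.pi ^ 2 * ε ≤ Real.pi ^ 2 * (c / (4 * Real.pi ^ 2)) := by
          gcongr; exact min_le_right _ _
      _ = c / 4 := by field_simp
  have hη : 0 < Real.pi * ε * c / 4 := by positivity
  obtain ⟨s, ⟨hs0, hs1⟩, hs⟩ : ∃ s : ℝ, s ∈ Set.Ioo (0 : ℝ) 1 ∧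
      volume (Aᶜ ∩ closedBall θ s) / volume (closedBall θ s) <
        ENNReal.ofReal (Real.pi * ε * c / 4) :=
    ((Filter.eventually_mem_set.2 (Ioo_mem_nhdsGT one_pos)).and
      (hθ.eventually_lt_const (ENNReal.ofReal_pos.2 hη))).exists
  have hsv : volume.real (Aᶜ ∩ closedBall θ s) ≤ Real.pi * ε * c / 4 * (2 * s) := by
    rw [Real.volume_closedBall, ENNReal.div_lt_iff (Or.inl (by simp [hs0]))
      (Or.inl ENNReal.ofReal_ne_top),
      ← ENNReal.ofReal_mul hη.le] at hs
    exact ENNReal.toReal_le_of_le_ofReal (by positivity) hs.le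
  have hε2 : ε ≤ 1 / 2 := min_le_left _ _
  have hr : 1 / 2 ≤ 1 - ε * s := by nlinarith
  have hr1 : 1 - ε * s < 1 := by nlinarith [mul_pos hε hs0]
  refine ⟨1 - ε * s, θ, by linarith, hr1, ?_⟩
  calc unitPoissonIntegral Aᶜ (1 - ε * s) θ
      ≤ Real.pi ^ 2 * ((1 - (1 - ε * s)) / s) +
        (Real.pi * (1 - (1 - ε * s)))⁻¹ * volume.real (Aᶜ ∩ closedBall θ s) :=
        unitPoissonIntegral_le hA.compl hr hr1 hs0 θ
    _ ≤ Real.pi ^ 2 * ((1 - (1 - ε * s)) / s) +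
        (Real.pi * (1 - (1 - ε * s)))⁻¹ * (Real.pi * ε * c / 4 * (2 * s)) := by
        rw [sub_sub_cancel]
        gcongr
    _ = Real.pi ^ 2 * ε + c / 2 := by
        rw [sub_sub_cancel]
        field_simp
        ring
    _ < c := by linarith

theorem unitPoisson_eq_poissonKernel (r x θ : ℝ) :
    poissonKernel 0 (r * exp (θ * I)) (circleMap 0 1 (x + θ)) = unitPoisson r x := by
  have h1 : circleMap 0 1 (x + θ) = exp (x * I) * exp (θ * I) := by
    simp [circleMap, ← exp_add, add_mul]
  have h2 : ‖exp (x * I) * exp (θ * I) - r * exp (θ * I)‖ = ‖exp (x * I) - r‖ := by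
    rw [← sub_mul, norm_mul, norm_exp_ofReal_mul_I, mul_one]
  rw [poissonKernel, h1, sub_zero, sub_zero, h2, unitPoisson]
  congr 1
  · simp [norm_exp_ofReal_mul_I]
  · rw [← normSq_eq_norm_sq, normSq_apply]
    simp only [sub_re, sub_im, exp_ofReal_mul_I_re, exp_ofReal_mul_I_im, ofReal_re, ofReal_im]
    nlinarith [Real.sin_sq_add_cos_sq x]

theorem circleIntegrable_indicator_one {S : Set ℂ} (hS : MeasurableSet S) (c : ℂ) (R : ℝ) :
    CircleIntegrable (S.indicator (1 : ℂ → ℝ)) c R := by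
  refine (intervalIntegrable_const (c := (1 : ℝ))).mono_fun'
    ((measurable_one.indicator hS).comp (measurable_circleMap c R)).aestronglyMeasurable
    (ae_of_all _ fun x => ?_)
  by_cases hx : circleMap c R x ∈ S <;> simp [hx]

theorem re_circleAverage_herglotz_indicator {S : Set ℂ} (hS : MeasurableSet S) {r : ℝ}
    (h0 : 0 ≤ r) (h1 : r < 1) (θ : ℝ) :
    (Real.circleAverage (fun ζ => herglotzRieszKernel 0 (r * exp (θ * I)) ζ •
      ((S.indicator 1 ζ : ℝ) : ℂ)) 0 1).re = unitPoissonIntegral (circleMap 0 1 ⁻¹' S) r θ := by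
  rw [re_circleAverage_herglotzRieszKernel_smul (circleIntegrable_indicator_one hS 0 1)
    (by simpa [norm_exp_ofReal_mul_I, abs_of_nonneg h0] using h1),
    ← poissonKernel_eq_re_herglotzRieszKernel, Real.circleAverage_eq_integral_add θ]
  simp only [Pi.smul_apply', unitPoisson_eq_poissonKernel, smul_eq_mul, unitPoissonIntegral]
  congr 1
  have hper : Function.Periodic
      (fun x : ℝ => unitPoisson r x * S.indicator 1 (circleMap 0 1 (x + θ))) (2 * Real.pi) := by
    intro x
    simp only [unitPoisson, Real.cos_add_two_pi, add_right_comm x, periodic_circleMap 0 1 _]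
  have := hper.intervalIntegral_add_eq 0 (-Real.pi)
  rw [zero_add, show -Real.pi + 2 * Real.pi = Real.pi by ring] at this
  exact this

/-- A set of positive measure on the circle has a holomorphic barrier, whose real part is positive
somewhere, but only inside the Stolz angles over the set. -/
theorem exists_stolzAngle_barrier {B : Set ℂ} (hB : MeasurableSet B)
    (hpos : 0 < volume {t : ℝ | exp (I * t) ∈ B}) :
    ∃ (h : ℂ → ℂ) (C : ℝ), DifferentiableOn ℂ h (ball 0 1) ∧
      (∀ z ∈ ball (0 : ℂ) 1, (h z).re ≤ C) ∧ (∃ z ∈ ball (0 : ℂ) 1, 0 < (h z).re) ∧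
      ∀ z ∈ ball (0 : ℂ) 1, 0 < (h z).re → ∃ ζ ∈ B, z ∈ stolzAngle ζ 2 := by
  have hpi := Real.pi_pos
  set A : Set ℝ := circleMap 0 1 ⁻¹' B
  have hA : MeasurableSet A := measurable_circleMap 0 1 hB
  have hApos : 0 < volume A := by
    convert hpos using 2
    ext t
    simp [A, circleMap, mul_comm]
  let c : ℝ := 1 / (4 * Real.pi)
  let H : ℂ → ℂ := fun z => Real.circleAverage (fun ζ => herglotzRieszKernel 0 z ζ •
    ((Bᶜ.indicator 1 ζ : ℝ) : ℂ)) 0 1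
  have hH : ∀ r θ : ℝ, 0 ≤ r → r < 1 →
      (c - H (r * exp (θ * I))).re = c - unitPoissonIntegral Aᶜ r θ := by
    intro r θ h0 h1
    rw [sub_re, ofReal_re, re_circleAverage_herglotz_indicator hB.compl h0 h1]
    rfl
  have hball : ∀ z ∈ ball (0 : ℂ) 1, (c - H z).re = c - unitPoissonIntegral Aᶜ ‖z‖ z.arg := by
    intro z hz
    rw [← hH _ _ (norm_nonneg z) (by simpa using hz), norm_mul_exp_arg_mul_I]
  refine ⟨fun z => c - H z, c, ?_, fun z hz => ?_, ?_, fun z hz hzpos => ?_⟩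
  · refine (differentiableOn_const _).sub
      (differentiableOn_circleAverage_herglotzRieszKernel_smul ?_)
    have := circleIntegrable_indicator_one hB.compl 0 1
    simp only [CircleIntegrable, intervalIntegrable_iff] at this ⊢
    exact ofRealCLM.integrable_comp this
  · rw [hball z hz]
    linarith [unitPoissonIntegral_nonneg Aᶜ (norm_nonneg z) (by simpa using hz) z.arg]
  · obtain ⟨r, θ, h0, h1, hlt⟩ := exists_unitPoissonIntegral_lt hA hApos
      (show 0 < c by positivity)
    refine ⟨r * exp (θ * I), ?_, ?_⟩
    · simpa [norm_exp_ofReal_mul_I, abs_of_nonneg h0] using h1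
    · rw [hH r θ h0 h1]
      linarith
  · rw [hball z hz] at hzpos
    have hz1 : ‖z‖ < 1 := by simpa using hz
    obtain ⟨x, hx, hxA⟩ : ∃ x, |x| < 1 - ‖z‖ ∧ x + z.arg ∈ A := by
      by_contra! hcon
      have := le_unitPoissonIntegral hA.compl (norm_nonneg z) hz1 hcon
      linarith
    refine ⟨_, hxA, hz1, ?_⟩
    have hexp : circleMap 0 1 (x + z.arg) - z =
        ((exp (I * x) - 1) + ((1 - ‖z‖ : ℝ) : ℂ)) * exp (z.arg * I) := by
      simp only [circleMap, zero_add, ofReal_one, one_mul, ofReal_add, add_mul, exp_add,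
        ofReal_sub, mul_comm I]
      linear_combination norm_mul_exp_arg_mul_I z
    rw [hexp, norm_mul, norm_exp_ofReal_mul_I, mul_one]
    calc ‖(exp (I * x) - 1) + ((1 - ‖z‖ : ℝ) : ℂ)‖
        ≤ ‖exp (I * x) - 1‖ + ‖((1 - ‖z‖ : ℝ) : ℂ)‖ := norm_add_le _ _
      _ ≤ |x| + (1 - ‖z‖) := by
          rw [norm_real, Real.norm_of_nonneg (by linarith)]
          gcongr
          exact Real.norm_exp_I_mul_ofReal_sub_one_le
      _ < 2 * (1 - ‖z‖) := by linarith

/-- Privalov's uniqueness theorem: a function analytic on the open unit disc with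
non-tangential limit zero at every point `e^{it}`, `t ∈ E`, where `E` has positive
Lebesgue measure, is identically zero. -/
theorem privalov_uniqueness (F : ℂ → ℂ) (hF : DifferentiableOn ℂ F (ball (0 : ℂ) 1))
    (E : Set ℝ) (hE : 0 < volume E)
    (hlim : ∀ t ∈ E, HasNontangentialLimit F (Complex.exp (Complex.I * t)) 0) :
    ∀ z ∈ ball (0 : ℂ) 1, F z = 0 := by
  obtain ⟨B, hB, hBpos, hBF⟩ := exists_uniform_nontangentialLimit hE hlim one_lt_two
  obtain ⟨h, C, hh, hC, ⟨z₀, hz₀, hz₀pos⟩, hhB⟩ := exists_stolzAngle_barrier hB hBpos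
  have hev : F =ᶠ[nhds z₀] 0 := by
    have hcont : ContinuousAt (fun z => (h z).re) z₀ :=
      continuous_re.continuousAt.comp (hh.continuousOn.continuousAt (isOpen_ball.mem_nhds hz₀))
    filter_upwards [isOpen_ball.mem_nhds hz₀, hcont.eventually_const_lt hz₀pos] with z hz hzpos
    exact eq_zero_of_barrier hF hh hBF hC hhB hz hzpos
  exact (hF.analyticOnNhd isOpen_ball).eqOn_zero_of_preconnected_of_eventuallyEq_zero
    (convex_ball _ _).isPreconnected hz₀ hev
end

section
/- If μ is a nonzero complex Borel measure on the circle with μ̂(n) = 0 for all n < 0, then μ is absolutely continuous with respect to Lebesgue measure. -/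
open MeasureTheory Complex Filter

instance : Fact (0 < 2 * Real.pi) := ⟨Real.two_pi_pos⟩

/-- The `n`-th Fourier coefficient of the complex measure `f dν` on the circle `ℝ/2πℤ`
(every complex Borel measure on the circle can be written this way, e.g. with `ν` its
total variation and `f` the Radon–Nikodym density): `μ̂(n) = ∫ e^{-int} f(t) dν(t)`. -/
noncomputable def cmFourierCoeff (ν : Measure (AddCircle (2 * Real.pi)))
    (f : AddCircle (2 * Real.pi) → ℂ) (n : ℤ) : ℂ :=
  ∫ x, (fourier (-n) x : ℂ) * f x ∂ν

open Set Metric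
open scoped Topology ENNReal

section Multipliers

variable {α : Type*} [MeasurableSpace α] {ν : Measure α} {z g : α → ℂ}

lemma integrable_pow_mul (hz : Measurable z) (hz1 : ∀ x, ‖z x‖ = 1) (hg : Integrable g ν)
    (k : ℕ) : Integrable (fun x => z x ^ k * g x) ν :=
  hg.bdd_mul (c := 1) (hz.pow_const k).aestronglyMeasurable (.of_forall fun x => by simp [hz1])

lemma integrable_inv_sub_mul (hz : Measurable z) (hz1 : ∀ x, ‖z x‖ = 1)
    (hg : Integrable g ν) {b : ℂ} (hb : 1 < ‖b‖) :
    Integrable (fun x => (z x - b)⁻¹ * g x) ν := by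
  refine hg.bdd_mul (c := (‖b‖ - 1)⁻¹) (hz.sub_const b).inv.aestronglyMeasurable
    (.of_forall fun x => ?_)
  rw [norm_inv]
  refine inv_anti₀ (by linarith) ?_
  have := norm_sub_norm_le b (z x)
  rw [hz1, norm_sub_rev] at this
  exact this

/-- If the positive moments of `g dν` vanish, so do those of `(z - b)⁻¹ g dν` when `|b| > 1`:
they form a bounded geometric sequence of ratio `b`. -/
lemma integral_pow_mul_inv_sub_mul_eq_zero (hz : Measurable z) (hz1 : ∀ x, ‖z x‖ = 1)
    (hg : Integrable g ν) (h : ∀ k : ℕ, 0 < k → ∫ x, z x ^ k * g x ∂ν = 0)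
    {b : ℂ} (hb : 1 < ‖b‖) (k : ℕ) (hk : 0 < k) :
    ∫ x, z x ^ k * ((z x - b)⁻¹ * g x) ∂ν = 0 := by
  have hne : ∀ x, z x - b ≠ 0 := fun x hx => by
    rw [sub_eq_zero] at hx
    rw [← hx, hz1] at hb
    exact lt_irrefl _ hb
  have hi := integrable_inv_sub_mul hz hz1 hg hb
  set G : α → ℂ := fun x => (z x - b)⁻¹ * g x with hG
  have hstep : ∀ m : ℕ, 0 < m → ∫ x, z x ^ (m + 1) * G x ∂ν = b * ∫ x, z x ^ m * G x ∂ν := by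
    intro m hm
    have h0 := h m hm
    have heq : ∀ x, z x ^ m * g x = z x ^ (m + 1) * G x - b * (z x ^ m * G x) := fun x => by
      have := hne x
      simp only [hG]
      field_simp
      ring
    simp_rw [heq] at h0
    rw [integral_sub (integrable_pow_mul hz hz1 hi _)
      ((integrable_pow_mul hz hz1 hi _).const_mul b), integral_const_mul] at h0
    exact sub_eq_zero.1 h0
  have hgeom : ∀ m : ℕ, ∫ x, z x ^ (k + m) * G x ∂ν = b ^ m * ∫ x, z x ^ k * G x ∂ν := by
    intro m
    induction m with
    | zero => simp
    | succ m ih => rw [← add_assoc, hstep _ (by omega), ih]; ring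
  have hbound : ∀ m : ℕ, ‖b‖ ^ m * ‖∫ x, z x ^ k * G x ∂ν‖ ≤ ∫ x, ‖G x‖ ∂ν := by
    intro m
    rw [← norm_pow, ← norm_mul, ← hgeom]
    refine (norm_integral_le_integral_norm _).trans_eq ?_
    simp [hz1]
  by_contra hc
  have ht : Tendsto (fun m : ℕ => ‖b‖ ^ m * ‖∫ x, z x ^ k * G x ∂ν‖) atTop atTop :=
    (tendsto_pow_atTop_atTop_of_one_lt hb).atTop_mul_const (norm_pos_iff.2 hc)
  obtain ⟨m, hm⟩ := (ht.eventually_gt_atTop (∫ x, ‖G x‖ ∂ν)).exists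
  exact absurd (hbound m) (not_le.2 hm)

lemma integral_pow_mul_prod_mul_eq_zero {ι : Type*} (hz : Measurable z)
    (hz1 : ∀ x, ‖z x‖ = 1) (hg : Integrable g ν)
    (h : ∀ k : ℕ, 0 < k → ∫ x, z x ^ k * g x ∂ν = 0) (s : Finset ι) (a b : ι → ℂ)
    (hb : ∀ j ∈ s, 1 < ‖b j‖) :
    Integrable (fun x => (∏ j ∈ s, (z x - a j) / (z x - b j)) * g x) ν ∧
      ∀ k : ℕ, 0 < k →
        ∫ x, z x ^ k * ((∏ j ∈ s, (z x - a j) / (z x - b j)) * g x) ∂ν = 0 := by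
  classical
  induction s using Finset.induction_on with
  | empty => simpa using ⟨hg, h⟩
  | insert i s hi ih =>
    obtain ⟨hint, hzero⟩ := ih fun j hj => hb j (Finset.mem_insert_of_mem hj)
    have hbi := hb i (Finset.mem_insert_self i s)
    set G : α → ℂ := fun x => (∏ j ∈ s, (z x - a j) / (z x - b j)) * g x with hG
    have heq : ∀ x, (∏ j ∈ insert i s, (z x - a j) / (z x - b j)) * g x =
        G x + (b i - a i) * ((z x - b i)⁻¹ * G x) := fun x => by
      have hne : z x - b i ≠ 0 := fun hx => by
        rw [sub_eq_zero] at hx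
        rw [← hx, hz1] at hbi
        exact lt_irrefl _ hbi
      rw [Finset.prod_insert hi, mul_assoc]
      change _ * G x = _
      field_simp
      ring
    have hinv := integrable_inv_sub_mul hz hz1 hint hbi
    simp_rw [heq]
    refine ⟨hint.add (hinv.const_mul _), fun k hk => ?_⟩
    have heq' : ∀ x, z x ^ k * (G x + (b i - a i) * ((z x - b i)⁻¹ * G x)) =
        z x ^ k * G x + (b i - a i) * (z x ^ k * ((z x - b i)⁻¹ * G x)) := fun x => by ring
    simp_rw [heq']
    rw [integral_add (integrable_pow_mul hz hz1 hint k)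
      ((integrable_pow_mul hz hz1 hinv k).const_mul _), integral_const_mul, hzero k hk,
      integral_pow_mul_inv_sub_mul_eq_zero hz hz1 hint hzero hbi k hk]
    simp

end Multipliers

section Covering

lemma exists_finset_cover_ball_sum_le {K : Set ℝ} (hK : IsCompact K) (h0 : volume K = 0)
    {ε : ℝ} (hε : 0 < ε) :
    ∃ (t : Finset ℝ) (r : ℝ → ℝ), (∀ x ∈ t, x ∈ K) ∧ (∀ x ∈ t, 0 < r x) ∧
      K ⊆ ⋃ x ∈ t, ball x (r x) ∧ ∑ x ∈ t, r x ≤ ε := by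
  obtain ⟨t, r, -, htK, hr, hcov, hsum⟩ :=
    Besicovitch.exists_closedBall_covering_tsum_measure_le (volume : Measure ℝ)
      (ENNReal.ofReal_pos.2 hε).ne' (fun _ => Ioi 0) K
      (fun x _ δ hδ => ⟨δ / 2, by simpa using hδ, by simpa using hδ, by linarith⟩)
  rw [h0, zero_add] at hsum
  have hopen : K ⊆ ⋃ x ∈ t, ball x (2 * r x) := hcov.trans <|
    iUnion₂_mono fun x hx => closedBall_subset_ball (by have : 0 < r x := hr x hx; linarith)
  obtain ⟨t', ht't, hfin, hcov'⟩ := hK.elim_finite_subcover_image (fun _ _ => isOpen_ball) hopen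
  have hpos : ∀ x ∈ hfin.toFinset, 0 < 2 * r x := fun x hx => by
    have : 0 < r x := hr x (ht't (hfin.mem_toFinset.1 hx))
    linarith
  refine ⟨hfin.toFinset, fun x => 2 * r x, fun x hx => htK (ht't (hfin.mem_toFinset.1 hx)), hpos,
    by simpa using hcov', ?_⟩
  rw [← ENNReal.ofReal_le_ofReal_iff hε.le,
    ENNReal.ofReal_sum_of_nonneg fun x hx => (hpos x hx).le]
  simp_rw [Real.volume_closedBall] at hsum
  refine le_trans ?_ hsum
  rw [tsum_subtype t fun x => ENNReal.ofReal (2 * r x)]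
  refine le_trans (Finset.sum_le_sum fun x hx => ?_) (ENNReal.sum_le_tsum hfin.toFinset)
  rw [indicator_of_mem (ht't (hfin.mem_toFinset.1 hx))]

lemma norm_fourier_one_sub_le (x y : ℝ) :
    ‖(fourier 1 (x : AddCircle (2 * Real.pi)) : ℂ) - fourier 1 (y : AddCircle (2 * Real.pi))‖
      ≤ |x - y| := by
  have hx : ∀ x : ℝ, (fourier 1 (x : AddCircle (2 * Real.pi)) : ℂ) = exp (I * x) := fun x => by
    rw [fourier_coe_apply]
    congr 1
    push_cast
    have : (Real.pi : ℂ) ≠ 0 := mod_cast Real.pi_ne_zero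
    field_simp
  rw [hx, hx]
  have : exp (I * x) - exp (I * y) = exp (I * y) * (exp (I * ((x - y : ℝ) : ℂ)) - 1) := by
    rw [mul_sub, ← Complex.exp_add]
    push_cast
    ring_nf
  rw [this, norm_mul, mul_comm I (y : ℂ), norm_exp_ofReal_mul_I, one_mul]
  exact Real.norm_exp_I_mul_ofReal_sub_one_le

lemma exists_finset_cover_fourier_sum_le {K : Set (AddCircle (2 * Real.pi))} (hK : IsClosed K)
    (h0 : volume K = 0) {ε : ℝ} (hε : 0 < ε) :
    ∃ (t : Finset ℝ) (r : ℝ → ℝ), (∀ y ∈ t, (y : AddCircle (2 * Real.pi)) ∈ K) ∧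
      (∀ y ∈ t, 0 < r y) ∧
      (∀ x ∈ K, ∃ y ∈ t, ‖(fourier 1 x : ℂ) - fourier 1 (y : AddCircle (2 * Real.pi))‖ ≤ r y) ∧
      ∑ y ∈ t, r y ≤ ε := by
  set π : ℝ → AddCircle (2 * Real.pi) := fun x => (x : AddCircle (2 * Real.pi))
  have hcont : Continuous π := AddCircle.continuous_mk' _
  have hcpt : IsCompact (π ⁻¹' K ∩ Icc 0 (0 + 2 * Real.pi)) :=
    isCompact_Icc.inter_left (hK.preimage hcont)
  have hnull : volume (π ⁻¹' K ∩ Icc 0 (0 + 2 * Real.pi)) = 0 := by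
    have := (AddCircle.measurePreserving_mk (2 * Real.pi) 0).measure_preimage
      hK.measurableSet.nullMeasurableSet
    rw [h0, Measure.restrict_congr_set Ioc_ae_eq_Icc,
      Measure.restrict_apply (hcont.measurable hK.measurableSet)] at this
    exact this
  obtain ⟨t, r, htK, hr, hcov, hsum⟩ := exists_finset_cover_ball_sum_le hcpt hnull hε
  refine ⟨t, r, fun y hy => (htK y hy).1, hr, fun x hx => ?_, hsum⟩
  obtain ⟨u, hu, rfl⟩ : x ∈ π '' Ico 0 (0 + 2 * Real.pi) := by
    rw [AddCircle.coe_image_Ico_eq]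
    exact mem_univ x
  obtain ⟨y, hy, hyu⟩ := mem_iUnion₂.1 (hcov ⟨hx, Ico_subset_Icc_self hu⟩)
  exact ⟨y, hy, (norm_fourier_one_sub_le u y).trans (mem_ball.1 hyu).le⟩

end Covering

section BlaschkeLikeFactor

variable {z a : ℂ} {s : ℝ}

lemma norm_sub_le_norm_sub_one_add_mul (hz : ‖z‖ = 1) (ha : ‖a‖ = 1) (hs : 0 ≤ s) :
    ‖z - a‖ ≤ ‖z - (1 + s) * a‖ := by
  have hz2 : z.re * z.re + z.im * z.im = 1 := by
    rw [← normSq_apply, normSq_eq_norm_sq, hz]; norm_num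
  have ha2 : a.re * a.re + a.im * a.im = 1 := by
    rw [← normSq_apply, normSq_eq_norm_sq, ha]; norm_num
  rw [← sq_le_sq₀ (norm_nonneg _) (norm_nonneg _), ← normSq_eq_norm_sq, ← normSq_eq_norm_sq,
    normSq_apply, normSq_apply]
  simp only [sub_re, sub_im, mul_re, mul_im, add_re, add_im, one_re, one_im, ofReal_re, ofReal_im]
  have hc : 0 ≤ 1 - (z.re * a.re + z.im * a.im) := by
    nlinarith [sq_nonneg (z.re - a.re), sq_nonneg (z.im - a.im)]
  nlinarith [mul_nonneg hs hc, sq_nonneg s]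

lemma norm_one_add_mul_of_norm_eq_one (ha : ‖a‖ = 1) (hs : 0 ≤ s) : ‖(1 + s) * a‖ = 1 + s := by
  rw [norm_mul, ha, mul_one, ← ofReal_one, ← ofReal_add, norm_real, Real.norm_of_nonneg]
  linarith

lemma le_norm_sub_one_add_mul (hz : ‖z‖ = 1) (ha : ‖a‖ = 1) (hs : 0 ≤ s) :
    s ≤ ‖z - (1 + s) * a‖ := by
  have := norm_sub_norm_le ((1 + s) * a) z
  rw [norm_one_add_mul_of_norm_eq_one ha hs, hz, norm_sub_rev] at this
  linarith

lemma norm_sub_div_sub_one_add_mul_le_one (hz : ‖z‖ = 1) (ha : ‖a‖ = 1) (hs : 0 ≤ s) :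
    ‖(z - a) / (z - (1 + s) * a)‖ ≤ 1 := by
  rw [norm_div]
  exact div_le_one_of_le₀ (norm_sub_le_norm_sub_one_add_mul hz ha hs) (norm_nonneg _)

lemma norm_sub_div_sub_one_add_mul_sub_one_le (hz : ‖z‖ = 1) (ha : ‖a‖ = 1) (hs : 0 < s)
    {δ : ℝ} (hδ : 0 < δ) (hza : δ ≤ ‖z - a‖) :
    ‖(z - a) / (z - (1 + s) * a) - 1‖ ≤ s / δ := by
  have hden := le_norm_sub_one_add_mul hz ha hs.le
  have hne : z - (1 + s) * a ≠ 0 := norm_pos_iff.1 (hs.trans_le hden)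
  have : (z - a) / (z - (1 + s) * a) - 1 = s * a / (z - (1 + s) * a) := by
    rw [div_sub_one hne]
    ring
  rw [this, norm_div, norm_mul, ha, mul_one, norm_real, Real.norm_of_nonneg hs.le]
  exact div_le_div_of_nonneg_left hs.le hδ
    (hza.trans (norm_sub_le_norm_sub_one_add_mul hz ha hs.le))

end BlaschkeLikeFactor

lemma norm_fourier_apply_eq_one (n : ℤ) (x : AddCircle (2 * Real.pi)) :
    ‖(fourier n x : ℂ)‖ = 1 := by
  rw [fourier_apply, Circle.norm_coe]

lemma fourier_natCast_eq_pow (k : ℕ) (x : AddCircle (2 * Real.pi)) :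
    (fourier (k : ℤ) x : ℂ) = (fourier 1 x : ℂ) ^ k := by
  induction k with
  | zero => simp
  | succ k ih => rw [Nat.cast_succ, fourier_add, ih, pow_succ]

lemma exists_pos_le_norm_fourier_one_sub {K : Set (AddCircle (2 * Real.pi))} (hK : IsClosed K)
    {x : AddCircle (2 * Real.pi)} (hx : x ∉ K) :
    ∃ δ > 0, ∀ y ∈ K, δ ≤ ‖(fourier 1 x : ℂ) - fourier 1 y‖ := by
  have hinj : Function.Injective (fun y : AddCircle (2 * Real.pi) => (fourier 1 y : ℂ)) := by
    intro u v huv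
    simp only [fourier_one] at huv
    exact AddCircle.injective_toCircle Real.two_pi_pos.ne' (Circle.ext huv)
  have hcl : IsClosed ((fun y : AddCircle (2 * Real.pi) => (fourier 1 y : ℂ)) '' K) :=
    (hK.isCompact.image (map_continuous (fourier 1))).isClosed
  have hnot : (fourier 1 x : ℂ) ∉ (fun y : AddCircle (2 * Real.pi) => (fourier 1 y : ℂ)) '' K :=
    fun h => hx ((hinj.mem_set_image).1 h)
  obtain ⟨δ, hδ, hball⟩ := Metric.isOpen_iff.1 hcl.isOpen_compl _ hnot
  refine ⟨δ, hδ, fun y hy => ?_⟩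
  by_contra! hlt
  refine hball (mem_ball.2 ?_) (mem_image_of_mem _ hy)
  rwa [dist_comm, dist_eq_norm]

/-- Øksendal's peaking products: finite products of Möbius factors with poles off the closed unit
disc, bounded by `1` on the circle and tending pointwise to the indicator of the complement of a
closed Lebesgue-null set. -/
lemma exists_seq_prod_tendsto_indicator_compl {K : Set (AddCircle (2 * Real.pi))}
    (hK : IsClosed K) (h0 : volume K = 0) :
    ∃ (t : ℕ → Finset ℝ) (a b : ℕ → ℝ → ℂ), (∀ n, ∀ y ∈ t n, 1 < ‖b n y‖) ∧
      (∀ n (x : AddCircle (2 * Real.pi)),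
        ‖∏ y ∈ t n, ((fourier 1 x : ℂ) - a n y) / (fourier 1 x - b n y)‖ ≤ 1) ∧
      ∀ x : AddCircle (2 * Real.pi), Tendsto
        (fun n => ∏ y ∈ t n, ((fourier 1 x : ℂ) - a n y) / (fourier 1 x - b n y)) atTop
        (𝓝 (Kᶜ.indicator 1 x)) := by
  have hN : ∀ n : ℕ, (0 : ℝ) < n + 1 := fun n => by positivity
  choose t r htK hr hcov hsum using fun n : ℕ =>
    exists_finset_cover_fourier_sum_le hK h0 (ε := 1 / ((n : ℝ) + 1) ^ 2)
      (by have := hN n; positivity)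
  set e : AddCircle (2 * Real.pi) → ℂ := fun x => fourier 1 x with he
  have he1 : ∀ x, ‖e x‖ = 1 := norm_fourier_apply_eq_one 1
  have hs : ∀ n, ∀ y ∈ t n, 0 < ((n : ℝ) + 1) * r n y := fun n y hy => mul_pos (hN n) (hr n y hy)
  have hfac : ∀ n, ∀ y ∈ t n, ∀ x,
      ‖(e x - e y) / (e x - (1 + (((n : ℝ) + 1) * r n y : ℝ)) * e y)‖ ≤ 1 := fun n y hy x =>
    norm_sub_div_sub_one_add_mul_le_one (he1 x) (he1 _) (hs n y hy).le
  have hlim := tendsto_one_div_add_atTop_nhds_zero_nat (𝕜 := ℝ)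
  refine ⟨t, fun _ y => e y, fun n y => (1 + (((n : ℝ) + 1) * r n y : ℝ)) * e y,
    fun n y hy => ?_, fun n x => ?_, fun x => ?_⟩
  · rw [norm_one_add_mul_of_norm_eq_one (he1 _) (hs n y hy).le]
    linarith [hs n y hy]
  · rw [norm_prod]
    exact Finset.prod_le_one (fun _ _ => norm_nonneg _) fun y hy => hfac n y hy x
  · by_cases hx : x ∈ K
    · rw [indicator_of_notMem (by simpa using hx)]
      refine squeeze_zero_norm (fun n => ?_) hlim
      obtain ⟨y, hy, hxy⟩ := hcov n x hx
      rw [← Finset.mul_prod_erase _ _ hy, norm_mul, norm_prod]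
      refine (mul_le_of_le_one_right (norm_nonneg _) (Finset.prod_le_one
        (fun _ _ => norm_nonneg _) fun w hw => hfac n w (Finset.mem_of_mem_erase hw) x)).trans ?_
      rw [norm_div]
      refine (div_le_div₀ (hr n y hy).le hxy (hs n y hy)
        (le_norm_sub_one_add_mul (he1 x) (he1 _) (hs n y hy).le)).trans_eq ?_
      have := (hr n y hy).ne'
      have := (hN n).ne'
      field_simp
    · rw [indicator_of_mem hx, Pi.one_apply, tendsto_iff_norm_sub_tendsto_zero]
      obtain ⟨δ, hδ, hdist⟩ := exists_pos_le_norm_fourier_one_sub hK hx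
      have hexp : Tendsto (fun n : ℕ => Real.exp (1 / ((n : ℝ) + 1) / δ) - 1) atTop (𝓝 0) := by
        simpa using ((Real.continuous_exp.tendsto _).comp (hlim.div_const δ)).sub_const 1
      refine squeeze_zero (fun _ => norm_nonneg _) (fun n => ?_) hexp
      have hprod := (t n).norm_prod_one_add_sub_one_le
        fun y : ℝ => (e x - e y) / (e x - (1 + (((n : ℝ) + 1) * r n y : ℝ)) * e y) - 1
      simp only [add_sub_cancel] at hprod
      refine hprod.trans (sub_le_sub_right (Real.exp_le_exp.2 ?_) 1)
      calc ∑ y ∈ t n, ‖(e x - e y) / (e x - (1 + (((n : ℝ) + 1) * r n y : ℝ)) * e y) - 1‖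
          ≤ ∑ y ∈ t n, ((n : ℝ) + 1) * r n y / δ := Finset.sum_le_sum fun y hy =>
            norm_sub_div_sub_one_add_mul_sub_one_le (he1 x) (he1 _) (hs n y hy) hδ
              (hdist _ (htK n y hy))
        _ = ((n : ℝ) + 1) * (∑ y ∈ t n, r n y) / δ := by rw [← Finset.sum_div, Finset.mul_sum]
        _ ≤ ((n : ℝ) + 1) * (1 / ((n : ℝ) + 1) ^ 2) / δ := by
            have := hN n
            have := hsum n
            gcongr
        _ = 1 / ((n : ℝ) + 1) / δ := by
            have := (hN n).ne'
            field_simp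

/-- A measure `f dν` with vanishing positive moments satisfies `∫_K e^{ix} f dν = 0` for every
closed Lebesgue-null set `K`. -/
lemma setIntegral_fourier_one_mul_eq_zero {ν : Measure (AddCircle (2 * Real.pi))}
    {f : AddCircle (2 * Real.pi) → ℂ} (hf : Integrable f ν)
    (h : ∀ k : ℕ, 0 < k → ∫ x, (fourier 1 x : ℂ) ^ k * f x ∂ν = 0)
    {K : Set (AddCircle (2 * Real.pi))} (hK : IsClosed K) (h0 : volume K = 0) :
    ∫ x in K, (fourier 1 x : ℂ) * f x ∂ν = 0 := by
  obtain ⟨t, a, b, hb, hle, hlim⟩ := exists_seq_prod_tendsto_indicator_compl hK h0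
  have hmeas : Measurable fun x : AddCircle (2 * Real.pi) => (fourier 1 x : ℂ) :=
    (map_continuous (fourier 1)).measurable
  have hnorm := norm_fourier_apply_eq_one 1
  have hef : Integrable (fun x => (fourier 1 x : ℂ) * f x) ν := by
    simpa using integrable_pow_mul hmeas hnorm hf 1
  have hprod := fun n =>
    integral_pow_mul_prod_mul_eq_zero hmeas hnorm hf h (t n) (a n) (b n) (hb n)
  have htend : Tendsto (fun n => ∫ x, (fourier 1 x : ℂ) ^ 1 *
      ((∏ y ∈ t n, ((fourier 1 x : ℂ) - a n y) / (fourier 1 x - b n y)) * f x) ∂ν) atTop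
      (𝓝 (∫ x, (fourier 1 x : ℂ) ^ 1 * (Kᶜ.indicator 1 x * f x) ∂ν)) := by
    refine tendsto_integral_of_dominated_convergence (fun x => ‖f x‖)
      (fun n => (integrable_pow_mul hmeas hnorm (hprod n).1 1).aestronglyMeasurable) hf.norm
      (fun n => .of_forall fun x => ?_) (.of_forall fun x => ?_)
    · rw [norm_mul, norm_pow, hnorm, one_pow, one_mul, norm_mul]
      exact mul_le_of_le_one_left (norm_nonneg _) (hle n x)
    · exact ((hlim x).mul_const _).const_mul _
  simp only [(hprod _).2 1 one_pos] at htend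
  have hcompl : ∫ x in Kᶜ, (fourier 1 x : ℂ) * f x ∂ν = 0 := by
    rw [← integral_indicator hK.measurableSet.compl, ← tendsto_nhds_unique htend tendsto_const_nhds]
    congr 1 with x
    by_cases hx : x ∈ K <;> simp [hx]
  have hadd := integral_add_compl hK.measurableSet hef
  rw [hcompl, add_zero] at hadd
  rw [hadd]
  simpa using h 1 one_pos

/-- A measure `f dν` with vanishing positive moments charges no closed Lebesgue-null set. -/
lemma ae_restrict_eq_zero_of_isClosed {ν : Measure (AddCircle (2 * Real.pi))}
    {f : AddCircle (2 * Real.pi) → ℂ} (hf : Integrable f ν)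
    (h : ∀ k : ℕ, 0 < k → ∫ x, (fourier 1 x : ℂ) ^ k * f x ∂ν = 0)
    {K : Set (AddCircle (2 * Real.pi))} (hK : IsClosed K) (h0 : volume K = 0) :
    f =ᵐ[ν.restrict K] 0 := by
  have hef : Integrable (fun x => (fourier 1 x : ℂ) * f x) ν := by
    simpa using integrable_pow_mul (map_continuous (fourier 1)).measurable
      (norm_fourier_apply_eq_one 1) hf 1
  have hae := ae_eq_zero_of_forall_setIntegral_isClosed_eq_zero (μ := ν.restrict K)
    hef.restrict fun s hs => by
      rw [Measure.restrict_restrict hs.measurableSet]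
      exact setIntegral_fourier_one_mul_eq_zero hf h (hs.inter hK)
        (measure_mono_null inter_subset_right h0)
  filter_upwards [hae] with x hx
  exact (mul_eq_zero.1 hx).resolve_left
    (norm_ne_zero_iff.1 (by rw [norm_fourier_apply_eq_one]; exact one_ne_zero))

/-- The F. and M. Riesz theorem: a nonzero complex Borel measure on the circle whose
Fourier coefficients vanish for all `n < 0` is absolutely continuous with respect to
Lebesgue (Haar) measure: every Borel set of Lebesgue measure zero has complex measure
zero. -/
theorem f_and_m_riesz (ν : Measure (AddCircle (2 * Real.pi))) [IsFiniteMeasure ν]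
    (f : AddCircle (2 * Real.pi) → ℂ) (hf : Integrable f ν)
    (hne : ¬ f =ᵐ[ν] 0)
    (h : ∀ n : ℤ, n < 0 → cmFourierCoeff ν f n = 0) :
    ∀ A : Set (AddCircle (2 * Real.pi)), MeasurableSet A → volume A = 0 →
      ∫ x in A, f x ∂ν = 0 := by
  intro A hA hA0
  have hmom : ∀ k : ℕ, 0 < k → ∫ x, (fourier 1 x : ℂ) ^ k * f x ∂ν = 0 := fun k hk => by
    simpa only [cmFourierCoeff, neg_neg, fourier_natCast_eq_pow] using h (-k) (by omega)
  have : IsFiniteMeasure (ν.withDensity fun x => ‖f x‖ₑ) :=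
    isFiniteMeasure_withDensity hf.hasFiniteIntegral.ne
  have hnull : (ν.withDensity fun x => ‖f x‖ₑ) A = 0 := by
    rw [hA.measure_eq_iSup_isCompact_of_ne_top (measure_ne_top _ _)]
    simp only [ENNReal.iSup_eq_zero]
    intro K hKA hK
    rw [withDensity_apply _ hK.measurableSet]
    refine lintegral_eq_zero_of_ae_eq_zero ?_
    filter_upwards [ae_restrict_eq_zero_of_isClosed hf hmom hK.isClosed
      (measure_mono_null hKA hA0)] with x hx
    simp [hx]
  rw [withDensity_apply _ hA] at hnull
  exact enorm_eq_zero.1 (le_antisymm ((enorm_integral_le_lintegral_enorm _).trans_eq hnull)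
    zero_le)
end

section
/- A vector x ∈ ℓ²(ℤ) is cyclic in ℓ²(ℤ) (i.e., the closed linear span of its translates is all of ℓ²(ℤ)) if and only if its Fourier transform x̂(t) = ∑_k x_k e^{ikt} is nonzero for Lebesgue-almost every t on the circle. -/
open Complex MeasureTheory AddCircle

/-- `x` is a cyclic vector in `ℓᵖ(ℤ)`: the closed linear span of the translates
`(x_{k-m})_k`, `m ∈ ℤ`, is all of `ℓᵖ(ℤ)`. -/
def IsCyclicVector (p : ENNReal) [Fact (1 ≤ p)] (x : ℤ → ℂ) : Prop :=
  Dense (↑(Submodule.span ℂ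
    {y : lp (fun _ : ℤ => ℂ) p | ∃ m : ℤ, ∀ k : ℤ, (y : ℤ → ℂ) k = x (k - m)}) :
    Set (lp (fun _ : ℤ => ℂ) p))

open scoped ComplexConjugate

/-- Integration against an integrable function, as a continuous linear functional on the space of
continuous functions on the circle. -/
noncomputable def integralMulCLM {T : ℝ} [Fact (0 < T)] {h : AddCircle T → ℂ}
    (hh : Integrable h haarAddCircle) : C(AddCircle T, ℂ) →L[ℂ] ℂ :=
  have hint (φ : C(AddCircle T, ℂ)) : Integrable (fun t ↦ φ t * h t) haarAddCircle :=
    hh.bdd_mul (c := ‖φ‖) φ.continuous.aestronglyMeasurable (ae_of_all _ φ.norm_coe_le_norm)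
  LinearMap.mkContinuous
    { toFun := fun φ ↦ ∫ t, φ t * h t ∂haarAddCircle
      map_add' := fun φ ψ ↦ by
        simp only [ContinuousMap.add_apply, add_mul]
        exact integral_add (hint φ) (hint ψ)
      map_smul' := fun c φ ↦ by
        simp only [ContinuousMap.smul_apply, smul_eq_mul, mul_assoc, RingHom.id_apply]
        exact integral_const_mul c _ }
    (∫ t, ‖h t‖ ∂haarAddCircle) fun φ ↦ by
      refine (norm_integral_le_integral_norm _).trans ?_
      rw [mul_comm, ← integral_const_mul]
      refine integral_mono (hint φ).norm (hh.norm.const_mul _) fun t ↦ ?_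
      simpa only [norm_mul] using
        mul_le_mul_of_nonneg_right (φ.norm_coe_le_norm t) (norm_nonneg (h t))

theorem integralMulCLM_apply {T : ℝ} [Fact (0 < T)] {h : AddCircle T → ℂ}
    (hh : Integrable h haarAddCircle) (φ : C(AddCircle T, ℂ)) :
    integralMulCLM hh φ = ∫ t, φ t * h t ∂haarAddCircle :=
  rfl

theorem integral_mul_eq_zero_of_fourierCoeff_eq_zero {T : ℝ} [Fact (0 < T)]
    {h : AddCircle T → ℂ} (hh : Integrable h haarAddCircle) (h0 : ∀ n, fourierCoeff h n = 0)
    (φ : C(AddCircle T, ℂ)) : ∫ t, φ t * h t ∂haarAddCircle = 0 := by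
  have hL : integralMulCLM hh = 0 := by
    refine ContinuousLinearMap.ext_on (s := Set.range (@fourier T)) ?_ ?_
    · exact Submodule.dense_iff_topologicalClosure_eq_top.2 span_fourier_closure_eq_top
    · rintro _ ⟨n, rfl⟩
      simpa [integralMulCLM_apply, fourierCoeff] using h0 (-n)
  rw [← integralMulCLM_apply hh, hL, zero_apply]

/-- An integrable function on the circle whose Fourier coefficients all vanish is zero almost
everywhere. -/
theorem ae_eq_zero_of_fourierCoeff_eq_zero {T : ℝ} [Fact (0 < T)] {h : AddCircle T → ℂ}
    (hh : Integrable h haarAddCircle) (h0 : ∀ n, fourierCoeff h n = 0) :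
    h =ᵐ[haarAddCircle] 0 := by
  refine ae_eq_zero_of_forall_setIntegral_isClosed_eq_zero hh fun s hs ↦ ?_
  rw [← integral_indicator hs.measurableSet]
  let φ (n : ℕ) : C(AddCircle T, ℂ) :=
    ⟨fun t ↦ ((hs.apprSeq n t : ℝ) : ℂ), by fun_prop⟩
  have hlim : Filter.Tendsto (fun n ↦ ∫ t, φ n t * h t ∂haarAddCircle) Filter.atTop
      (nhds (∫ t, s.indicator h t ∂haarAddCircle)) := by
    refine tendsto_integral_of_dominated_convergence (fun t ↦ ‖h t‖)
      (fun n ↦ (φ n).continuous.aestronglyMeasurable.mul hh.1) hh.norm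
      (fun n ↦ ae_of_all _ fun t ↦ ?_) (ae_of_all _ fun t ↦ ?_)
    · rw [norm_mul]
      refine mul_le_of_le_one_left (norm_nonneg _) ?_
      simpa [φ] using HasOuterApproxClosed.apprSeq_apply_le_one hs n t
    · have ht := tendsto_pi_nhds.1 (HasOuterApproxClosed.tendsto_apprSeq hs) t
      have hc : Continuous fun r : NNReal ↦ ((r : ℝ) : ℂ) * h t := by fun_prop
      refine ((hc.tendsto _).comp ht).congr' (.of_forall fun n ↦ rfl) |>.trans_eq ?_
      by_cases hts : t ∈ s <;> simp [hts]
  simp only [integral_mul_eq_zero_of_fourierCoeff_eq_zero hh h0] at hlim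
  exact tendsto_nhds_unique hlim tendsto_const_nhds

theorem memLp_fourier_mul {T : ℝ} [Fact (0 < T)] {p : ENNReal} {f : AddCircle T → ℂ}
    (hf : MemLp f p haarAddCircle) (m : ℤ) :
    MemLp (fun t ↦ fourier m t * f t) p haarAddCircle :=
  hf.congr_norm ((fourier m).continuous.aestronglyMeasurable.mul hf.1)
    (ae_of_all _ fun t ↦ by rw [norm_mul, fourier_apply, Circle.norm_coe, one_mul])

theorem fourierCoeff_fourier_mul {T : ℝ} [Fact (0 < T)] (f : AddCircle T → ℂ) (m k : ℤ) :
    fourierCoeff (fun t ↦ fourier m t * f t) k = fourierCoeff f (k - m) := by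
  unfold fourierCoeff
  congr 1 with t
  rw [smul_eq_mul, smul_eq_mul, ← mul_assoc, ← fourier_add, neg_sub', sub_neg_eq_add]

/-- The function on the circle whose Fourier coefficients are the translate by `m` of those
of `f`. -/
noncomputable def fourierMulLp {T : ℝ} [Fact (0 < T)] (m : ℤ)
    (f : Lp ℂ 2 (@haarAddCircle T _)) : Lp ℂ 2 (@haarAddCircle T _) :=
  (memLp_fourier_mul (Lp.memLp f) m).toLp

theorem fourierBasis_repr_fourierMulLp {T : ℝ} [Fact (0 < T)] (m k : ℤ)
    (f : Lp ℂ 2 (@haarAddCircle T _)) :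
    fourierBasis.repr (fourierMulLp m f) k = fourierBasis.repr f (k - m) := by
  rw [fourierBasis_repr, fourierBasis_repr, ← fourierCoeff_fourier_mul]
  exact congrFun (fourierCoeff_congr_ae (MemLp.coeFn_toLp _)) k

theorem inner_fourierMulLp {T : ℝ} [Fact (0 < T)] (m : ℤ) (f g : Lp ℂ 2 (@haarAddCircle T _)) :
    inner ℂ (fourierMulLp m f) g = fourierCoeff (fun t ↦ conj (f t) * g t) m := by
  rw [L2.inner_def, fourierCoeff]
  refine integral_congr_ae ?_
  filter_upwards [(memLp_fourier_mul (Lp.memLp f) m).coeFn_toLp] with t ht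
  rw [fourierMulLp, ht, RCLike.inner_apply', map_mul, fourier_neg, smul_eq_mul, mul_assoc]

/-- `g` is orthogonal to all products of `f` with characters if and only if `f` and `g` have
almost everywhere disjoint supports. -/
theorem forall_inner_fourierMulLp_eq_zero_iff {T : ℝ} [Fact (0 < T)]
    (f g : Lp ℂ 2 (@haarAddCircle T _)) :
    (∀ m, inner ℂ (fourierMulLp m f) g = 0) ↔ ∀ᵐ t ∂(@haarAddCircle T _), f t = 0 ∨ g t = 0 := by
  simp only [inner_fourierMulLp]
  constructor
  · intro h
    have hint : Integrable (fun t ↦ conj (f t) * g t) (@haarAddCircle T _) := by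
      simpa only [RCLike.inner_apply'] using L2.integrable_inner (𝕜 := ℂ) f g
    filter_upwards [ae_eq_zero_of_fourierCoeff_eq_zero hint h] with t ht
    simpa using ht
  · intro h m
    refine integral_eq_zero_of_ae ?_
    filter_upwards [h] with t ht
    rcases ht with ht | ht <;> simp [ht]

theorem isCyclicVector_two_iff (x : lp (fun _ : ℤ => ℂ) 2) :
    IsCyclicVector 2 (x : ℤ → ℂ) ↔
      ∀ g : Lp ℂ 2 (@haarAddCircle (2 * Real.pi) _),
        (∀ m, inner ℂ (fourierMulLp m (fourierBasis.repr.symm x)) g = 0) → g = 0 := by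
  have hset : {y : lp (fun _ : ℤ => ℂ) 2 | ∃ m : ℤ, ∀ k : ℤ, (y : ℤ → ℂ) k = x (k - m)} =
      Set.range fun m ↦ (@fourierBasis (2 * Real.pi) _).repr
        (fourierMulLp m (fourierBasis.repr.symm x)) := by
    ext y
    refine exists_congr fun m ↦ ?_
    rw [eq_comm, lp.ext_iff, funext_iff]
    simp only [fourierBasis_repr_fourierMulLp, LinearIsometryEquiv.apply_symm_apply]
  rw [IsCyclicVector, hset, Submodule.dense_iff_topologicalClosure_eq_top,
    Submodule.topologicalClosure_eq_top_iff, Submodule.eq_bot_iff,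
    (@fourierBasis (2 * Real.pi) _).repr.surjective.forall]
  refine forall_congr' fun g ↦ ?_
  rw [Submodule.mem_orthogonal, LinearIsometryEquiv.map_eq_zero_iff]
  refine imp_congr_left ⟨fun h m ↦ ?_, fun h u hu ↦ ?_⟩
  · simpa using h _ (Submodule.subset_span ⟨m, rfl⟩)
  · induction hu using Submodule.span_induction with
    | mem u hu =>
      obtain ⟨m, rfl⟩ := hu
      simpa using h m
    | zero => simp
    | add u v _ _ hu hv => rw [inner_add_left, hu, hv, add_zero]
    | smul c u _ hu => rw [inner_smul_left, hu, mul_zero]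

/-- Wiener's theorem: `x ∈ ℓ²(ℤ)` is cyclic in `ℓ²(ℤ)` iff its Fourier transform
(the `L²` function `∑_k x_k e^{ikt}` given by the Fourier isometry between `ℓ²(ℤ)`
and `L²` of the circle) is nonzero almost everywhere. -/
theorem wiener_l2_cyclic (x : lp (fun _ : ℤ => ℂ) 2) :
    IsCyclicVector 2 (x : ℤ → ℂ) ↔
      ∀ᵐ t ∂(@haarAddCircle (2 * Real.pi) _),
        ((fourierBasis.repr.symm x : Lp ℂ 2 (@haarAddCircle (2 * Real.pi) _)) :
          AddCircle (2 * Real.pi) → ℂ) t ≠ 0 := by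
  rw [isCyclicVector_two_iff]
  simp only [forall_inner_fourierMulLp_eq_zero_iff]
  generalize (fourierBasis.repr.symm x : Lp ℂ 2 (@haarAddCircle (2 * Real.pi) _)) = f
  constructor
  · intro h
    have hs : MeasurableSet {t | f t = 0} :=
      (Lp.stronglyMeasurable f).measurable (measurableSet_singleton 0)
    let g := indicatorConstLp 2 hs (measure_ne_top (@haarAddCircle (2 * Real.pi) _) _) (1 : ℂ)
    have hg : g =ᵐ[haarAddCircle] {t | f t = 0}.indicator fun _ ↦ (1 : ℂ) :=
      indicatorConstLp_coeFn
    have hg0 : g = 0 := h g <| by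
      filter_upwards [hg] with t ht
      by_cases hft : f t = 0 <;> simp [ht, hft]
    rw [hg0] at hg
    filter_upwards [hg] with t ht hft
    simp [hft] at ht
  · intro h g hg
    rw [Lp.eq_zero_iff_ae_eq_zero]
    filter_upwards [h, hg] with t ht hgt
    exact hgt.resolve_left ht
end
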